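/- Let d ≥ 2 and p ∈ [1, ∞). There exists a constant C(d, p) ≥ 1 such that for every sequence (c_n)_{n∈ℕ} of nonnegative reals, setting N = c_0 + ( ∑_{n≥1} n^{d/2 − 1} ( ∑_{k≥n} c_k² / k^{d/2} )^{p/2} )^{1/p} ∈ [0, ∞], one has (1/C(d,p)) · N ≤ ‖ √( ∑_{n≥0} c_n² · e_d(n, x) / D(d,n) ) ‖_{L^p_x(ℝ^d)} ≤ C(d,p) · N, both sides being possibly infinite simultaneously. -/

import Mathlib

open MeasureTheory
open scoped ENNReal NNReal

/-- The `n`-th physicists' Hermite polynomial `H_n(x) = (−1)^n e^{x²} (d/dx)^n e^{−x²}`. -/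
noncomputable def hermitePoly (n : ℕ) (x : ℝ) : ℝ :=
  (-1 : ℝ) ^ n * Real.exp (x ^ 2) * iteratedDeriv n (fun t => Real.exp (-t ^ 2)) x

/-- The `n`-th (L²-normalized) Hermite function
`h_n(x) = H_n(x) e^{−x²/2} / √(n! 2^n √π)`. -/
noncomputable def hermiteFun (n : ℕ) (x : ℝ) : ℝ :=
  hermitePoly n x * Real.exp (-x ^ 2 / 2) /
    Real.sqrt ((n.factorial : ℝ) * 2 ^ n * Real.sqrt Real.pi)

/-- The spectral function of the `n`-th eigenspace of the harmonic oscillator `−Δ + |x|²`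
on `ℝ^d`: `e_d(n, x) = ∑_{i₁+⋯+i_d = n} h_{i₁}(x₁)² ⋯ h_{i_d}(x_d)²`. -/
noncomputable def eSpec (d n : ℕ) (x : Fin d → ℝ) : ℝ :=
  ∑ i ∈ Finset.Nat.antidiagonalTuple d n, ∏ k, (hermiteFun (i k) (x k)) ^ 2

/-- `D(d, n) = binom(n+d−1, d−1)`, the dimension of the `n`-th eigenspace. -/
def Ddim (d n : ℕ) : ℕ := Nat.choose (n + d - 1) (d - 1)

/-- The probabilistic Lebesgue norm `‖√(∑_n c_n² e_d(n,·)/D(d,n))‖_{L^p(ℝ^d)}`,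
computed in `[0, ∞]`. -/
noncomputable def hermitePLnorm (d : ℕ) (p : ℝ) (c : ℕ → ℝ) : ℝ≥0∞ :=
  (∫⁻ x : Fin d → ℝ,
      (∑' n : ℕ, ENNReal.ofReal ((c n) ^ 2 * eSpec d n x / (Ddim d n))) ^ (p / 2)
    ∂volume) ^ (1 / p)

/-- The discrete quantity
`N = c_0 + (∑_{n≥1} n^{d/2−1} (∑_{k≥n} c_k²/k^{d/2})^{p/2})^{1/p}`, in `[0, ∞]`. -/
noncomputable def hermiteDiscreteNorm (d : ℕ) (p : ℝ) (c : ℕ → ℝ) : ℝ≥0∞ :=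
  ENNReal.ofReal (c 0) +
    (∑' m : ℕ, ((m + 1 : ℕ) : ℝ≥0∞) ^ ((d : ℝ) / 2 - 1) *
        (∑' j : ℕ, ENNReal.ofReal ((c (m + 1 + j)) ^ 2) /
            ((m + 1 + j : ℕ) : ℝ≥0∞) ^ ((d : ℝ) / 2)) ^ (p / 2)) ^ (1 / p)

open MeasureTheory
open scoped ENNReal NNReal

/-! Part 1: Hermite functions -/

noncomputable def gH (n : ℕ) (x : ℝ) : ℝ := iteratedDeriv n (fun t => Real.exp (-t ^ 2)) x

lemma gH_zero (x : ℝ) : gH 0 x = Real.exp (-x ^ 2) := by simp [gH]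

lemma gH_hasDeriv (n : ℕ) (x : ℝ) : HasDerivAt (gH n) (gH (n+1) x) x := by
  have hs : ContDiff ℝ ((⊤ : ℕ∞) : WithTop ℕ∞) (fun t : ℝ => Real.exp (-t ^ 2)) := by fun_prop
  have h1 : Differentiable ℝ (gH n) := by
    have := hs.differentiable_iteratedDeriv n (WithTop.coe_lt_coe.2 (ENat.natCast_lt_top n))
    exact this
  have h2 := (h1 x).hasDerivAt
  have h3 : deriv (gH n) x = gH (n+1) x := by
    unfold gH; rw [iteratedDeriv_succ]
  rwa [h3] at h2

lemma gH_one (x : ℝ) : gH 1 x = -2 * x * gH 0 x := by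
  have h1 := gH_hasDeriv 0 x
  have h2 : HasDerivAt (gH 0) (-2 * x * gH 0 x) x := by
    have h3 : gH 0 = fun t => Real.exp (-t ^ 2) := by funext t; exact gH_zero t
    rw [h3]
    have h4 : HasDerivAt (fun t : ℝ => -t ^ 2) (-2 * x) x :=
      ((hasDerivAt_pow 2 x).neg).congr_deriv (by norm_num)
    exact h4.exp.congr_deriv (by ring)
  exact h1.unique h2

lemma gH_rec (n : ℕ) (x : ℝ) : gH (n+2) x = -2 * x * gH (n+1) x - 2 * (n+1) * gH n x := by
  induction n generalizing x with
  | zero =>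
    have h1 := gH_hasDeriv 1 x
    have h2 : HasDerivAt (gH 1) (-2 * gH 0 x + (-2 * x) * gH 1 x) x := by
      have h3 : gH 1 = fun t => -2 * t * gH 0 t := by funext t; exact gH_one t
      have h4 : HasDerivAt (fun t : ℝ => -2 * t) (-2) x := by
        simpa using (hasDerivAt_id x).const_mul (-2)
      have := h4.mul (gH_hasDeriv 0 x)
      rw [h3]
      rw [← h3]
      simpa [h3, Pi.mul_def] using this
    have := h1.unique h2
    simp only [zero_add] at *
    rw [this]; push_cast; ring
  | succ n ih =>
    have h1 := gH_hasDeriv (n+2) x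
    have h2 : HasDerivAt (gH (n+2))
        ((-2 * gH (n+1) x + (-2 * x) * gH (n+2) x) - 2 * (n+1) * gH (n+1) x) x := by
      have h3 : gH (n+2) = fun t => -2 * t * gH (n+1) t - 2 * (n+1) * gH n t := by
        funext t; exact ih t
      have h4 : HasDerivAt (fun t : ℝ => -2 * t) (-2) x := by
        simpa using (hasDerivAt_id x).const_mul (-2)
      have := (h4.mul (gH_hasDeriv (n+1) x)).sub ((gH_hasDeriv n x).const_mul (2 * ((n:ℝ)+1)))
      exact this.congr_of_eventuallyEq (Filter.Eventually.of_forall ih)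
    have := h1.unique h2
    rw [show n + 1 + 2 = n + 2 + 1 from rfl, this]; push_cast; ring

noncomputable def nrm (n : ℕ) : ℝ := (n.factorial : ℝ) * 2 ^ n * Real.sqrt Real.pi

lemma nrm_pos (n : ℕ) : 0 < nrm n := by unfold nrm; positivity

lemma nrm_succ (n : ℕ) : nrm (n+1) = 2 * (n+1) * nrm n := by
  unfold nrm; rw [Nat.factorial_succ]; push_cast; ring

/-- square of Hermite function -/
noncomputable def aH (n : ℕ) (x : ℝ) : ℝ := (hermiteFun n x) ^ 2

lemma aH_nonneg (n : ℕ) (x : ℝ) : 0 ≤ aH n x := sq_nonneg _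

lemma aH_eq (n : ℕ) (x : ℝ) : aH n x = (gH n x) ^ 2 * Real.exp (x ^ 2) / nrm n := by
  unfold aH hermiteFun hermitePoly
  rw [div_pow, Real.sq_sqrt (by positivity)]
  change ((-1 : ℝ) ^ n * Real.exp (x ^ 2) * gH n x * Real.exp (-x ^ 2 / 2)) ^ 2 / nrm n = _
  congr 1
  have h1 : ((-1 : ℝ) ^ n) ^ 2 = 1 := by rw [← pow_mul, mul_comm, pow_mul]; simp
  have h2 : Real.exp (x ^ 2) ^ 2 * Real.exp (-x ^ 2 / 2) ^ 2 = Real.exp (x ^ 2) := by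
    rw [← Real.exp_nat_mul, ← Real.exp_nat_mul, ← Real.exp_add]; congr 1; push_cast; ring
  calc _ = ((-1 : ℝ) ^ n) ^ 2 * (Real.exp (x ^ 2) ^ 2 * Real.exp (-x ^ 2 / 2) ^ 2) * gH n x ^ 2 := by ring
    _ = _ := by rw [h1, h2]; ring

/-- derivative of `aH` -/
noncomputable def aH' (n : ℕ) (x : ℝ) : ℝ :=
  (2 * gH n x * gH (n+1) x + gH n x ^ 2 * (2 * x)) * Real.exp (x ^ 2) / nrm n

lemma aH_hasDeriv (n : ℕ) (x : ℝ) : HasDerivAt (aH n) (aH' n x) x := by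
  have h : aH n = fun x => (gH n x) ^ 2 * Real.exp (x ^ 2) / nrm n := by funext x; exact aH_eq n x
  rw [h]
  have := (((gH_hasDeriv n x).pow 2).mul ((hasDerivAt_pow 2 x).exp)).div_const (nrm n)
  refine this.congr_deriv ?_
  unfold aH'; simp; ring

lemma aH'_zero (x : ℝ) : aH' 0 x = - (2 * x) * aH 0 x := by
  rw [aH_eq]; unfold aH'; rw [zero_add, gH_one]; ring

lemma aH'_succ (n : ℕ) (x : ℝ) :
    aH' (n+1) x + aH' n x = - (2 * x) * (aH (n+1) x - aH n x) := by
  rw [aH_eq, aH_eq]; unfold aH'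
  rw [show n + 1 + 1 = n + 2 from rfl, gH_rec, nrm_succ]
  have := (nrm_pos n).ne'
  have h2 : (n:ℝ) + 1 ≠ 0 := by positivity
  field_simp
  ring

lemma aH_zero_zero : aH 0 0 = 1 / Real.sqrt Real.pi := by
  rw [aH_eq, gH_zero]; simp [nrm]

lemma aH_one_zero : aH 1 0 = 0 := by
  rw [aH_eq, gH_one]; simp

lemma aH_rec_zero (n : ℕ) : (n + 2) * aH (n+2) 0 = (n+1) * aH n 0 := by
  rw [aH_eq, aH_eq, gH_rec, nrm_succ, nrm_succ]
  have := (nrm_pos n).ne'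
  have h2 : (n:ℝ) + 1 ≠ 0 := by positivity
  have h3 : (n:ℝ) + 2 ≠ 0 := by positivity
  push_cast
  field_simp
  ring

lemma aH_continuous (n : ℕ) : Continuous (aH n) :=
  continuous_iff_continuousAt.2 fun x => (aH_hasDeriv n x).continuousAt

lemma gH_ne (n : ℕ) : ∃ x, gH n x ≠ 0 := by
  by_contra! h
  have key : ∀ k, ∀ x, gH (n - k) x = 0 := by
    intro k
    induction k with
    | zero => simpa using h
    | succ k ih =>
      intro x
      by_cases hk : n ≤ k
      · have : n - (k+1) = n - k := by omega
        rw [this]; exact ih x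
      · obtain ⟨m, hm⟩ : ∃ m, n - k = m + 1 := ⟨n - k - 1, by omega⟩
        have hm2 : n - (k+1) = m := by omega
        rw [hm] at ih
        rw [hm2]
        have h0 : HasDerivAt (gH (m+1)) 0 x := by
          have : gH (m+1) = fun _ => 0 := funext ih
          rw [this]; exact hasDerivAt_const _ _
        have h1 := (gH_hasDeriv (m+1) x).unique h0
        have h2 := gH_rec m x
        rw [show m + 1 + 1 = m + 2 from rfl] at h1
        rw [h1, ih x] at h2
        have h3 : (2 * ((m:ℝ)+1)) ≠ 0 := by positivity
        have h4 : 2 * ((m:ℝ)+1) * gH m x = 0 := by linarith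
        exact (mul_eq_zero.1 h4).resolve_left h3
  have := key n 0
  rw [Nat.sub_self, gH_zero] at this
  exact (Real.exp_pos _).ne' this

lemma aH_ne (n : ℕ) : ∃ x, 0 < aH n x := by
  obtain ⟨x, hx⟩ := gH_ne n
  refine ⟨x, ?_⟩
  rw [aH_eq]
  have := nrm_pos n
  positivity

open MeasureTheory
open scoped ENNReal NNReal

/-! Part 2: radial recursion -/

/-- convolution -/
noncomputable def convo (f g : ℕ → ℝ) (n : ℕ) : ℝ :=
  ∑ ij ∈ Finset.HasAntidiagonal.antidiagonal n, f ij.1 * g ij.2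

lemma mk_conv (f g : ℕ → ℝ) : PowerSeries.mk (convo f g) = PowerSeries.mk f * PowerSeries.mk g := by
  ext n; simp [PowerSeries.coeff_mul, convo]

def IsRec (κ : ℝ → ℝ) (f f' : ℕ → ℝ → ℝ) : Prop :=
  (∀ n s, HasDerivAt (f n) (f' n s) s) ∧
  ∀ s, (1 + PowerSeries.X) * PowerSeries.mk (fun n => f' n s) =
    - PowerSeries.C (κ s) * (1 - PowerSeries.X) * PowerSeries.mk (fun n => f n s)

lemma isRec_of (κ : ℝ → ℝ) (f f' : ℕ → ℝ → ℝ) (h : ∀ n s, HasDerivAt (f n) (f' n s) s)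
    (h0 : ∀ s, f' 0 s = - κ s * f 0 s)
    (h1 : ∀ n s, f' (n+1) s + f' n s = - κ s * (f (n+1) s - f n s)) : IsRec κ f f' := by
  refine ⟨h, fun s => ?_⟩
  ext n
  cases n with
  | zero => simp [add_mul, sub_mul, mul_assoc, h0]
  | succ n =>
    rw [neg_mul, neg_mul, mul_assoc]
    simp [add_mul, sub_mul, PowerSeries.coeff_succ_X_mul]
    have := h1 n s
    linarith

lemma IsRec.zero {κ : ℝ → ℝ} {f f' : ℕ → ℝ → ℝ} (h : IsRec κ f f') (s : ℝ) :
    f' 0 s = - κ s * f 0 s := by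
  have := congrArg (PowerSeries.coeff 0) (h.2 s)
  simpa [add_mul, sub_mul, mul_assoc] using this

lemma IsRec.succ {κ : ℝ → ℝ} {f f' : ℕ → ℝ → ℝ} (h : IsRec κ f f') (n : ℕ) (s : ℝ) :
    f' (n+1) s + f' n s = - κ s * (f (n+1) s - f n s) := by
  have := congrArg (PowerSeries.coeff (n+1)) (h.2 s)
  rw [neg_mul, neg_mul, mul_assoc] at this
  simp [add_mul, sub_mul, PowerSeries.coeff_succ_X_mul] at this
  linarith

lemma IsRec.conv {κ₁ κ₂ : ℝ → ℝ} {f f' g g' : ℕ → ℝ → ℝ} (hf : IsRec κ₁ f f')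
    (hg : IsRec κ₂ g g') :
    IsRec (fun s => κ₁ s + κ₂ s) (fun n s => convo (fun i => f i s) (fun i => g i s) n)
      (fun n s => convo (fun i => f' i s) (fun i => g i s) n
        + convo (fun i => f i s) (fun i => g' i s) n) := by
  constructor
  · intro n s
    unfold convo
    beta_reduce
    rw [← Finset.sum_add_distrib]
    exact HasDerivAt.fun_sum fun ij _ => (hf.1 ij.1 s).mul (hg.1 ij.2 s)
  · intro s
    have e1 : PowerSeries.mk (fun n => convo (fun i => f' i s) (fun i => g i s) n
        + convo (fun i => f i s) (fun i => g' i s) n)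
        = PowerSeries.mk (fun i => f' i s) * PowerSeries.mk (fun i => g i s)
          + PowerSeries.mk (fun i => f i s) * PowerSeries.mk (fun i => g' i s) := by
      rw [← mk_conv, ← mk_conv]; ext n; simp
    rw [e1, mk_conv, map_add]
    linear_combination (PowerSeries.mk (fun i => g i s)) * hf.2 s
      + (PowerSeries.mk (fun i => f i s)) * hg.2 s

lemma IsRec.const_conv {κ : ℝ → ℝ} {f f' : ℕ → ℝ → ℝ} (hf : IsRec κ f f') (b : ℕ → ℝ) :
    IsRec κ (fun n s => convo b (fun i => f i s) n)
      (fun n s => convo b (fun i => f' i s) n) := by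
  constructor
  · intro n s
    unfold convo
    exact HasDerivAt.fun_sum fun ij _ => (hf.1 ij.2 s).const_mul _
  · intro s
    rw [mk_conv, mk_conv]
    linear_combination (PowerSeries.mk b) * hf.2 s

lemma IsRec.unique {ρ : ℝ} {f f' g g' : ℕ → ℝ → ℝ} (hf : IsRec (fun s => 2 * ρ * s) f f')
    (hg : IsRec (fun s => 2 * ρ * s) g g') (h0 : ∀ n, f n 0 = g n 0) (n : ℕ) :
    ∀ s, f n s = g n s := by
  have aux : ∀ D D' : ℝ → ℝ, (∀ s, HasDerivAt D (D' s) s) → (∀ s, D' s = - (2 * ρ * s) * D s) →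
      D 0 = 0 → ∀ s, D s = 0 := by
    intro D D' h1 h2 h3 s
    have h4 : ∀ s, HasDerivAt (fun s => D s * Real.exp (ρ * s ^ 2)) 0 s := by
      intro s
      have h5 : HasDerivAt (fun s : ℝ => ρ * s ^ 2) (ρ * (2 * s)) s :=
        ((hasDerivAt_pow 2 s).const_mul ρ).congr_deriv (by norm_num)
      refine ((h1 s).mul h5.exp).congr_deriv ?_
      rw [h2]; ring
    have h6 := is_const_of_deriv_eq_zero (fun s => (h4 s).differentiableAt)
      (fun s => (h4 s).deriv) s 0
    simp only [h3, zero_mul] at h6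
    exact (mul_eq_zero.1 h6).resolve_right (Real.exp_pos _).ne'
  induction n with
  | zero =>
    intro s
    have := aux (fun s => f 0 s - g 0 s) (fun s => f' 0 s - g' 0 s)
      (fun s => (hf.1 0 s).sub (hg.1 0 s))
      (fun s => by simp only [hf.zero, hg.zero]; ring) (by simp [h0]) s
    linarith
  | succ n ih =>
    intro s
    have hd : ∀ s, f' n s = g' n s := by
      intro s
      have h1 := hf.1 n s
      have h2 : f n = g n := funext ih
      rw [h2] at h1
      exact h1.unique (hg.1 n s)
    have := aux (fun s => f (n+1) s - g (n+1) s) (fun s => f' (n+1) s - g' (n+1) s)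
      (fun s => (hf.1 (n+1) s).sub (hg.1 (n+1) s))
      (fun s => by
        have h1 := hf.succ n s
        have h2 := hg.succ n s
        rw [hd, ih] at h1
        linarith) (by simp [h0]) s
    linarith

lemma IsRec.comp_sq {f f' : ℕ → ℝ → ℝ} (hf : IsRec (fun _ => 1) f f') (ρ : ℝ) :
    IsRec (fun s => 2 * ρ * s) (fun n s => f n (s ^ 2 * ρ))
      (fun n s => f' n (s ^ 2 * ρ) * (2 * ρ * s)) := by
  apply isRec_of
  · intro n s
    have h5 : HasDerivAt (fun s : ℝ => s ^ 2 * ρ) (2 * ρ * s) s :=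
      ((hasDerivAt_pow 2 s).mul_const ρ).congr_deriv (by norm_num; ring)
    exact (hf.1 n (s ^ 2 * ρ)).comp s h5
  · intro s
    rw [hf.zero]; ring
  · intro n s
    have := hf.succ n (s ^ 2 * ρ)
    linear_combination (2 * ρ * s) * this

lemma eSpec_zero (n : ℕ) (x : Fin 0 → ℝ) : eSpec 0 n x = if n = 0 then 1 else 0 := by
  unfold eSpec
  cases n <;> simp

lemma eSpec_succ (d n : ℕ) (x : Fin (d+1) → ℝ) :
    eSpec (d+1) n x = convo (fun i => aH i (x 0)) (fun i => eSpec d i (fun k => x k.succ)) n := by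
  unfold convo eSpec
  simp_rw [Finset.mul_sum]
  rw [Finset.sum_sigma']
  refine Finset.sum_bij' (fun a _ => ⟨(a 0, ∑ k : Fin d, a k.succ), fun k => a k.succ⟩)
    (fun b _ => Fin.cons b.1.1 b.2) ?_ ?_ ?_ ?_ ?_
  · intro a ha
    rw [Finset.Nat.mem_antidiagonalTuple, Fin.sum_univ_succ] at ha
    simp [Finset.Nat.mem_antidiagonalTuple, ha]
  · rintro ⟨⟨i, j⟩, b⟩ hb
    simp only [Finset.mem_sigma, Finset.HasAntidiagonal.mem_antidiagonal, Finset.Nat.mem_antidiagonalTuple] at hb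
    rw [Finset.Nat.mem_antidiagonalTuple, Fin.sum_univ_succ]
    simp [hb]
  · intro a ha
    funext k
    refine Fin.cases ?_ (fun k => ?_) k <;> simp
  · rintro ⟨⟨i, j⟩, b⟩ hb
    simp only [Finset.mem_sigma, Finset.HasAntidiagonal.mem_antidiagonal, Finset.Nat.mem_antidiagonalTuple] at hb
    obtain ⟨h1, h2⟩ := hb
    subst h2
    simp
  · intro a ha
    rw [Fin.prod_univ_succ]
    rfl

lemma eSpec_isRec (d : ℕ) (x : Fin d → ℝ) :
    ∃ f', IsRec (fun s => 2 * (∑ k, x k ^ 2) * s) (fun n s => eSpec d n (fun k => s * x k)) f' := by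
  induction d with
  | zero =>
    refine ⟨fun _ _ => 0, ?_⟩
    apply isRec_of
    · intro n s
      simp only [eSpec_zero]
      exact hasDerivAt_const _ _
    · intro s; simp
    · intro n s; simp
  | succ d ih =>
    obtain ⟨f', hf'⟩ := ih (fun k => x k.succ)
    have h1 : IsRec (fun s => 2 * (x 0) ^ 2 * s) (fun n s => aH n (s * x 0))
        (fun n s => aH' n (s * x 0) * x 0) := by
      apply isRec_of
      · intro n s
        have h5 : HasDerivAt (fun s : ℝ => s * x 0) (x 0) s := by
          simpa using (hasDerivAt_id s).mul_const (x 0)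
        exact (aH_hasDeriv n (s * x 0)).comp s h5
      · intro s; rw [aH'_zero]; ring
      · intro n s
        have := aH'_succ n (s * x 0)
        linear_combination (x 0) * this
    have h2 := h1.conv hf'
    refine ⟨fun n s => convo (fun i => aH' i (s * x 0) * x 0)
      (fun i => eSpec d i fun k => s * x k.succ) n +
      convo (fun i => aH i (s * x 0)) (fun i => f' i s) n, ?_⟩
    · convert h2 using 1
      · funext s; rw [Fin.sum_univ_succ]; ring
      · funext n s; rw [eSpec_succ]

lemma eSpec_nonneg (d n : ℕ) (x : Fin d → ℝ) : 0 ≤ eSpec d n x := by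
  unfold eSpec; positivity

lemma eSpec_continuous (d n : ℕ) : Continuous (eSpec d n) := by
  unfold eSpec
  refine continuous_finsetSum _ fun i _ => continuous_finsetProd _ fun k _ => ?_
  exact (aH_continuous (i k)).comp (continuous_apply k)

/-- A family with the right recursion and initial data computes `eSpec`. -/
lemma eSpec_eq_of (d : ℕ) (E E' : ℕ → ℝ → ℝ) (hE : IsRec (fun _ => 1) E E')
    (h0 : ∀ n, E n 0 = eSpec d n 0) (n : ℕ) (x : Fin d → ℝ) :
    eSpec d n x = E n (∑ k, x k ^ 2) := by
  obtain ⟨f', hf'⟩ := eSpec_isRec d x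
  have h := hf'.unique (hE.comp_sq (∑ k, x k ^ 2)) (by
    intro m
    simp only [zero_mul]
    have : (0:ℝ) ^ 2 * ∑ k, x k ^ 2 = 0 := by ring
    rw [this, h0]; rfl) n 1
  simpa using h

lemma eSpec_pos (d n : ℕ) : ∃ x, 0 < eSpec (d+1) n x := by
  obtain ⟨t, ht⟩ := aH_ne n
  obtain ⟨u, hu⟩ := aH_ne 0
  refine ⟨Fin.cons t (fun _ => u), ?_⟩
  unfold eSpec
  refine Finset.sum_pos' (fun i _ => by positivity) ⟨Fin.cons n (fun _ => 0), ?_, ?_⟩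
  · rw [Finset.Nat.mem_antidiagonalTuple, Fin.sum_univ_succ]; simp
  · rw [Fin.prod_univ_succ]
    simp only [Fin.cons_zero, Fin.cons_succ]
    exact mul_pos ht (Finset.prod_pos fun _ _ => hu)

open MeasureTheory
open scoped ENNReal NNReal

/-! Part 3: Laguerre polynomials and the two-dimensional spectral function -/

lemma mvt_bound {G G' Z Z' : ℝ → ℝ} {a b : ℝ} (hab : a ≤ b)
    (hG : ∀ t ∈ Set.Icc a b, HasDerivAt G (G' t) t) (hZ : ∀ t ∈ Set.Icc a b, HasDerivAt Z (Z' t) t)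
    (h : ∀ t ∈ Set.Icc a b, |G' t| ≤ Z' t) : |G b - G a| ≤ Z b - Z a := by
  have key : ∀ H H' : ℝ → ℝ, (∀ t ∈ Set.Icc a b, HasDerivAt H (H' t) t) →
      (∀ t ∈ Set.Icc a b, 0 ≤ H' t) → H a ≤ H b := by
    intro H H' h1 h2
    have := monotoneOn_of_deriv_nonneg (convex_Icc a b)
      (fun t ht => (h1 t ht).continuousAt.continuousWithinAt)
      (fun t ht => (h1 t (interior_subset ht)).differentiableAt.differentiableWithinAt)
      (fun t ht => by rw [(h1 t (interior_subset ht)).deriv]; exact h2 t (interior_subset ht))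
    exact this (Set.left_mem_Icc.2 hab) (Set.right_mem_Icc.2 hab) hab
  have h1 := key (fun t => Z t - G t) (fun t => Z' t - G' t) (fun t ht => (hZ t ht).sub (hG t ht))
    (fun t ht => by have := (abs_le.1 (h t ht)).2; linarith)
  have h2 := key (fun t => Z t + G t) (fun t => Z' t + G' t) (fun t ht => (hZ t ht).add (hG t ht))
    (fun t ht => by have := (abs_le.1 (h t ht)).1; linarith)
  rw [abs_le]; constructor <;> linarith

open Polynomial in
/-- rescaled Laguerre polynomials `L_n^{(1)}(2X)` -/
noncomputable def LagP : ℕ → ℝ[X]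
  | 0 => 1
  | 1 => C 2 - C 2 * X
  | (n+2) => C (1 / ((n:ℝ)+2)) * ((C (2 * (n:ℝ) + 4) - C 2 * X) * LagP (n+1) - C ((n:ℝ)+2) * LagP n)

noncomputable def Le (n : ℕ) (t : ℝ) : ℝ := (LagP n).eval t
noncomputable def Ld (n : ℕ) (t : ℝ) : ℝ := (Polynomial.derivative (LagP n)).eval t
noncomputable def Ldd (n : ℕ) (t : ℝ) : ℝ :=
  (Polynomial.derivative (Polynomial.derivative (LagP n))).eval t

lemma Le_hasDeriv (n : ℕ) (t : ℝ) : HasDerivAt (Le n) (Ld n t) t := (LagP n).hasDerivAt t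
lemma Ld_hasDeriv (n : ℕ) (t : ℝ) : HasDerivAt (Ld n) (Ldd n t) t :=
  (Polynomial.derivative (LagP n)).hasDerivAt t

lemma Le_rec (n : ℕ) (t : ℝ) :
    ((n:ℝ)+2) * Le (n+2) t = (2 * n + 4 - 2 * t) * Le (n+1) t - (n+2) * Le n t := by
  have : (n:ℝ) + 2 ≠ 0 := by positivity
  simp only [Le, LagP, Polynomial.eval_mul, Polynomial.eval_sub, Polynomial.eval_C,
    Polynomial.eval_X]
  field_simp

lemma Ld_rec (n : ℕ) (t : ℝ) :
    ((n:ℝ)+2) * Ld (n+2) t = (2 * n + 4 - 2 * t) * Ld (n+1) t - 2 * Le (n+1) t - (n+2) * Ld n t := by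
  have : (n:ℝ) + 2 ≠ 0 := by positivity
  simp only [Le, Ld, LagP, Polynomial.derivative_mul, Polynomial.derivative_sub,
    Polynomial.derivative_C, Polynomial.derivative_X, Polynomial.eval_add,
    Polynomial.eval_mul, Polynomial.eval_sub, Polynomial.eval_C,
    Polynomial.eval_X, Polynomial.eval_zero, Polynomial.eval_one]
  field_simp
  ring

lemma Le_AB (n : ℕ) : (∀ t, t * Ld (n+1) t = (n+1) * Le (n+1) t - (n+2) * Le n t) ∧
    (∀ t, Ld (n+1) t = Ld n t - 2 * Le n t) := by
  induction n with
  | zero =>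
    constructor <;> intro t <;> simp [Le, Ld, LagP] <;> ring
  | succ n ih =>
    obtain ⟨hA, hB⟩ := ih
    have h2 : (n:ℝ) + 2 ≠ 0 := by positivity
    have hB' : ∀ t, Ld (n+2) t = Ld (n+1) t - 2 * Le (n+1) t := by
      intro t
      have e1 := Ld_rec n t
      have e2 := hA t
      have e3 := hB t
      have : ((n:ℝ)+2) * (Ld (n+2) t - (Ld (n+1) t - 2 * Le (n+1) t)) = 0 := by
        linear_combination e1 - 2 * e2 + (n+2) * e3
      have := (mul_eq_zero.1 this).resolve_left h2
      linarith
    refine ⟨fun t => ?_, hB'⟩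
    have e1 := Le_rec n t
    have e2 := hA t
    have e3 := hB' t
    push_cast
    linear_combination t * e3 + e2 - e1

lemma L_ode (n : ℕ) (t : ℝ) : t * Ldd n t + (2 - 2 * t) * Ld n t + 2 * n * Le n t = 0 := by
  cases n with
  | zero => simp [Ldd, Ld, LagP]
  | succ n =>
    obtain ⟨hA, hB⟩ := Le_AB n
    have h1 : HasDerivAt (fun t => t * Ld (n+1) t) (1 * Ld (n+1) t + t * Ldd (n+1) t) t :=
      (hasDerivAt_id t).mul (Ld_hasDeriv (n+1) t)
    have h2 : HasDerivAt (fun t => t * Ld (n+1) t)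
        (((n:ℝ)+1) * Ld (n+1) t - (n+2) * Ld n t) t := by
      have h3 : (fun t => t * Ld (n+1) t) = fun t => ((n:ℝ)+1) * Le (n+1) t - (n+2) * Le n t :=
        funext hA
      rw [h3]
      exact ((Le_hasDeriv (n+1) t).const_mul _).sub ((Le_hasDeriv n t).const_mul _)
    have e := h1.unique h2
    have e2 := hA t
    have e3 := hB t
    push_cast
    linear_combination e + (n+2) * e3 - 2 * e2

lemma Le_at_zero (n : ℕ) : Le n 0 = n + 1 := by
  have : ∀ n, Le n 0 = n + 1 ∧ Le (n+1) 0 = n + 2 := by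
    intro n
    induction n with
    | zero => simp [Le, LagP]
    | succ n ih =>
      refine ⟨by rw [ih.2]; push_cast; ring, ?_⟩
      have e := Le_rec n 0
      rw [ih.1, ih.2] at e
      have h2 : (n:ℝ) + 2 ≠ 0 := by positivity
      have : ((n:ℝ)+2) * (Le (n+2) 0 - (n+3)) = 0 := by linear_combination e
      have := (mul_eq_zero.1 this).resolve_left h2
      rw [show n + 1 + 1 = n + 2 from rfl]
      push_cast
      linarith
  exact (this n).1

open Polynomial in
noncomputable def Fp : ℕ → ℝ[X]
  | 0 => 1
  | (n+1) => Fp n + C ((-1:ℝ)^(n+1)) * (LagP (n+1) - LagP n)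

noncomputable def Fe (n : ℕ) (t : ℝ) : ℝ := (Fp n).eval t
noncomputable def Fd (n : ℕ) (t : ℝ) : ℝ := (Polynomial.derivative (Fp n)).eval t

lemma Fe_succ (n : ℕ) (t : ℝ) : Fe (n+1) t = Fe n t + (-1:ℝ)^(n+1) * (Le (n+1) t - Le n t) := by
  simp [Fe, Le, Fp]

lemma Fd_succ (n : ℕ) (t : ℝ) : Fd (n+1) t = Fd n t + (-1:ℝ)^(n+1) * (Ld (n+1) t - Ld n t) := by
  simp only [Fd, Ld, Fp, Polynomial.derivative_add, Polynomial.derivative_C_mul, Polynomial.derivative_sub,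
    Polynomial.eval_add, Polynomial.eval_mul, Polynomial.eval_C, Polynomial.eval_sub]

lemma Fe_hasDeriv (n : ℕ) (t : ℝ) : HasDerivAt (Fe n) (Fd n t) t := (Fp n).hasDerivAt t

lemma Fd_eq (n : ℕ) (t : ℝ) : Fd n t = Fe n t - (-1:ℝ)^n * Le n t := by
  induction n with
  | zero => simp [Fd, Fe, Le, Fp, LagP]
  | succ n ih =>
    rw [Fd_succ, Fe_succ, ih, (Le_AB n).2, pow_succ]; ring

lemma Fe_at_zero (n : ℕ) : Fe (n+1) 0 = Fe n 0 + (-1:ℝ)^(n+1) := by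
  rw [Fe_succ, Le_at_zero, Le_at_zero]; push_cast; ring

lemma Fe_at_zero' (n : ℕ) : Fe n 0 = (1 + (-1:ℝ)^n) / 2 := by
  induction n with
  | zero => simp [Fe, Fp]
  | succ n ih => rw [Fe_at_zero, ih, pow_succ]; ring

/-- `π e_2(n, ·)` as a function of `|x|²` -/
noncomputable def f2 (n : ℕ) (t : ℝ) : ℝ := Real.exp (-t) * Fe n t
noncomputable def w2 (n : ℕ) (t : ℝ) : ℝ := Real.exp (-t) * (-((-1:ℝ)^n) * Le n t)
noncomputable def w2' (n : ℕ) (t : ℝ) : ℝ := Real.exp (-t) * (-((-1:ℝ)^n) * (Ld n t - Le n t))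
noncomputable def u2 (n : ℕ) (t : ℝ) : ℝ :=
  Real.exp (-t) * (-((-1:ℝ)^n) * ((1 - t) * Le n t + t * Ld n t))

lemma hasDeriv_exp_neg (t : ℝ) : HasDerivAt (fun t : ℝ => Real.exp (-t)) (-Real.exp (-t)) t := by
  have := (hasDerivAt_id t).neg.exp
  exact this.congr_deriv (by simp)

lemma f2_hasDeriv (n : ℕ) (t : ℝ) : HasDerivAt (f2 n) (w2 n t) t := by
  refine ((hasDeriv_exp_neg t).mul (Fe_hasDeriv n t)).congr_deriv ?_
  rw [Fd_eq]; unfold w2; ring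

lemma w2_hasDeriv (n : ℕ) (t : ℝ) : HasDerivAt (w2 n) (w2' n t) t := by
  refine ((hasDeriv_exp_neg t).mul ((Le_hasDeriv n t).const_mul (-((-1:ℝ)^n)))).congr_deriv ?_
  unfold w2'; ring

lemma v2_hasDeriv (n : ℕ) (t : ℝ) : HasDerivAt (fun t => t * w2 n t) (u2 n t) t := by
  refine ((hasDerivAt_id t).mul (w2_hasDeriv n t)).congr_deriv ?_
  unfold u2 w2 w2'; simp only [id]; ring

lemma u2_hasDeriv (n : ℕ) (t : ℝ) :
    HasDerivAt (u2 n) (-((2 * n + 2) - t) * w2 n t) t := by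
  have h1 : HasDerivAt (fun t : ℝ => 1 - t) (-1) t := by
    simpa using (hasDerivAt_id t).const_sub 1
  refine ((hasDeriv_exp_neg t).mul (((h1.mul (Le_hasDeriv n t)).add
    ((hasDerivAt_id t).mul (Ld_hasDeriv n t))).const_mul (-((-1:ℝ)^n)))).congr_deriv ?_
  have e := L_ode n t
  unfold w2
  simp only [id, Pi.add_apply, Pi.mul_apply]
  linear_combination (Real.exp (-t) * (-((-1:ℝ)^n))) * e

lemma f2_isRec : IsRec (fun _ => 1) f2 w2 := by
  apply isRec_of
  · exact f2_hasDeriv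
  · intro s; simp [w2, f2, Le, Fe, LagP, Fp]
  · intro n s
    unfold w2 f2
    rw [Fe_succ, pow_succ]; ring

lemma f2_at_zero (n : ℕ) : f2 n 0 = (1 + (-1:ℝ)^n) / 2 := by
  unfold f2; rw [Fe_at_zero']; simp

lemma u2_at_zero (n : ℕ) : u2 n 0 = -((-1:ℝ)^n) * (n + 1) := by
  unfold u2; rw [Le_at_zero]; simp

open PowerSeries in
lemma eSpec_two_zero (n : ℕ) : eSpec 2 n 0 = f2 n 0 / Real.pi := by
  set B : PowerSeries ℝ := PowerSeries.mk (fun n => aH n 0) with hB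
  have h1 : PowerSeries.mk (fun n => eSpec 2 n 0) = B * B := by
    have e1 : (fun n => eSpec 2 n 0) = convo (fun i => aH i 0) (fun i => eSpec 1 i 0) := by
      funext n; rw [eSpec_succ]; rfl
    have e2 : (fun n => eSpec 1 n 0) = convo (fun i => aH i 0) (fun i => eSpec 0 i 0) := by
      funext n; rw [eSpec_succ]; rfl
    have e3 : PowerSeries.mk (fun n => eSpec 0 n 0) = 1 := by
      ext n; rw [PowerSeries.coeff_mk, eSpec_zero, PowerSeries.coeff_one]
    rw [e1, mk_conv, e2, mk_conv, e3, mul_one]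
  have h2 : (1 - X ^ 2) * d⁄dX ℝ B = X * B := by
    ext n
    rw [sub_mul, map_sub, one_mul, pow_two, mul_assoc]
    rcases n with _ | _ | n
    · simp [PowerSeries.coeff_derivative, hB, aH_one_zero]
    · simp [PowerSeries.coeff_derivative, PowerSeries.coeff_succ_X_mul, hB]
      have := aH_rec_zero 0
      norm_num at this ⊢
      linarith
    · simp [PowerSeries.coeff_derivative, PowerSeries.coeff_succ_X_mul, hB]
      have := aH_rec_zero (n+1)
      push_cast at this
      rw [show n + 1 + 2 = n + 1 + 1 + 1 from rfl] at this
      linarith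
  have h3 : (1 - X ^ 2) * (B * B) = PowerSeries.C (1 / Real.pi) := by
    apply PowerSeries.derivative.ext
    · have e : d⁄dX ℝ (1 - X ^ 2 : PowerSeries ℝ) = - 2 * X := by
        rw [map_sub, pow_two, Derivation.leibniz]
        simp [PowerSeries.derivative_X]
        ring
      rw [Derivation.leibniz, Derivation.leibniz, e, PowerSeries.derivative_C]
      simp only [smul_eq_mul]
      linear_combination (2 * B) * h2
    · have : aH 0 0 * aH 0 0 = 1 / Real.pi := by
        rw [aH_zero_zero]
        have := Real.mul_self_sqrt Real.pi_pos.le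
        rw [div_mul_div_comm, this, one_mul]
      simp only [map_mul, map_sub, map_one, map_pow, PowerSeries.constantCoeff_X,
        PowerSeries.constantCoeff_C, hB]
      rw [← this]
      simp
  rw [← h1] at h3
  have c0 : eSpec 2 0 0 = 1 / Real.pi := by
    have := congrArg (PowerSeries.coeff 0) h3
    simpa [sub_mul, pow_two] using this
  have c1 : eSpec 2 1 0 = 0 := by
    have := congrArg (PowerSeries.coeff 1) h3
    rw [sub_mul, map_sub, one_mul, pow_two, mul_assoc] at this
    rw [PowerSeries.coeff_succ_X_mul] at this
    simpa [PowerSeries.coeff_C] using this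
  have c2 : ∀ n, eSpec 2 (n+2) 0 = eSpec 2 n 0 := by
    intro n
    have := congrArg (PowerSeries.coeff (n+2)) h3
    rw [sub_mul, map_sub, one_mul, pow_two, mul_assoc] at this
    rw [PowerSeries.coeff_succ_X_mul, PowerSeries.coeff_succ_X_mul] at this
    simp [PowerSeries.coeff_C] at this
    linarith
  rw [f2_at_zero]
  have : ∀ n, eSpec 2 n 0 = (1 + (-1:ℝ)^n) / 2 / Real.pi ∧
      eSpec 2 (n+1) 0 = (1 + (-1:ℝ)^(n+1)) / 2 / Real.pi := by
    intro n
    induction n with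
    | zero => rw [c0, zero_add, c1]; norm_num
    | succ n ih =>
      refine ⟨ih.2, ?_⟩
      rw [show n + 1 + 1 = n + 2 from rfl, c2, ih.1, pow_add]; norm_num
  exact (this n).1

/-- radial profile of the spectral function in dimension `k+2` -/
noncomputable def Erad : ℕ → ℕ → ℝ → ℝ
  | 0 => fun n t => f2 n t / Real.pi
  | (k+1) => fun n t => convo (fun i => aH i 0) (fun i => Erad k i t) n

lemma Erad_spec (k : ℕ) : (∃ E', IsRec (fun _ => 1) (Erad k) E') ∧
    ∀ n, Erad k n 0 = eSpec (k+2) n 0 := by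
  induction k with
  | zero =>
    refine ⟨⟨fun n t => w2 n t / Real.pi, ?_⟩, fun n => (eSpec_two_zero n).symm⟩
    apply isRec_of
    · intro n s; exact (f2_hasDeriv n s).div_const _
    · intro s; simp only [Erad]; rw [f2_isRec.zero]; ring
    · intro n s; simp only [Erad]
      have := f2_isRec.succ n s
      linear_combination (1 / Real.pi) * this
  | succ k ih =>
    obtain ⟨⟨E', hE'⟩, h0⟩ := ih
    refine ⟨⟨_, hE'.const_conv (fun i => aH i 0)⟩, fun n => ?_⟩
    rw [eSpec_succ]
    simp only [Erad, h0]
    rfl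

lemma eSpec_eq_Erad (k n : ℕ) (x : Fin (k+2) → ℝ) :
    eSpec (k+2) n x = Erad k n (∑ i, x i ^ 2) := by
  obtain ⟨⟨E', hE'⟩, h0⟩ := Erad_spec k
  exact eSpec_eq_of (k+2) (Erad k) E' hE' h0 n x

lemma Erad_nonneg (k n : ℕ) {t : ℝ} (ht : 0 ≤ t) : 0 ≤ Erad k n t := by
  have h := eSpec_eq_Erad k n (Fin.cons (Real.sqrt t) 0)
  have h2 : ∑ i : Fin (k+2), (Fin.cons (Real.sqrt t) 0 : Fin (k+2) → ℝ) i ^ 2 = t := by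
    rw [Fin.sum_univ_succ]; simp [Real.sq_sqrt ht]
  rw [h2] at h
  rw [← h]; exact eSpec_nonneg _ _ _

lemma f2_nonneg (n : ℕ) {t : ℝ} (ht : 0 ≤ t) : 0 ≤ f2 n t := by
  have := Erad_nonneg 0 n ht
  simp only [Erad] at this
  have h := mul_nonneg this Real.pi_pos.le
  rwa [div_mul_cancel₀ _ Real.pi_pos.ne'] at h

lemma Fe_bound (n : ℕ) : ∀ t, 0 ≤ t → |Fe n t| ≤ 7 ^ n * Real.exp (t / 2) := by
  induction n with
  | zero =>
    intro t ht
    simp [Fe, Fp]; linarith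
  | succ n ih =>
    intro t ht
    have hd : ∀ s, HasDerivAt (fun s => Fe (n+1) s + Fe n s) (2 * Fe n s) s := by
      intro s
      refine ((Fe_hasDeriv (n+1) s).add (Fe_hasDeriv n s)).congr_deriv ?_
      rw [Fd_eq, Fd_eq, Fe_succ, pow_succ]; ring
    have hz : ∀ s, HasDerivAt (fun s : ℝ => 4 * 7 ^ n * Real.exp (s / 2))
        (2 * (7 ^ n * Real.exp (s / 2))) s := by
      intro s
      have := (((hasDerivAt_id s).div_const 2).exp).const_mul (4 * 7 ^ n)
      refine this.congr_deriv ?_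
      simp only [id]; ring
    have := mvt_bound ht (fun s _ => hd s) (fun s _ => hz s) (fun s hs => by
      rw [abs_mul, abs_of_pos (two_pos : (0:ℝ) < 2)]
      exact mul_le_mul_of_nonneg_left (ih s hs.1) (by norm_num))
    have h0 : Fe (n+1) 0 + Fe n 0 = 1 := by
      rw [Fe_at_zero', Fe_at_zero', pow_succ]; ring
    rw [h0] at this
    simp only [zero_div, Real.exp_zero, mul_one] at this
    have h1 := ih t ht
    have h2 : (1:ℝ) ≤ 7 ^ n := one_le_pow₀ (by norm_num)
    have h3 := Real.exp_pos (t/2)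
    have h5 : (0:ℝ) < 7 ^ n * Real.exp (t / 2) := by positivity
    rw [abs_le] at *
    rw [pow_succ]
    constructor <;> nlinarith

lemma f2_tail (n : ℕ) {t : ℝ} (ht : 0 ≤ t) : f2 n t ≤ 7 ^ n * Real.exp (-t / 2) := by
  unfold f2
  have h := (le_abs_self _).trans (Fe_bound n t ht)
  calc Real.exp (-t) * Fe n t ≤ Real.exp (-t) * (7 ^ n * Real.exp (t / 2)) :=
        mul_le_mul_of_nonneg_left h (Real.exp_pos _).le
    _ = 7 ^ n * (Real.exp (-t) * Real.exp (t / 2)) := by ring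
    _ = _ := by rw [← Real.exp_add]; congr 2; ring

lemma f2_tendsto (n : ℕ) : Filter.Tendsto (f2 n) Filter.atTop (nhds 0) := by
  have h := Polynomial.tendsto_div_exp_atTop (Fp n)
  refine h.congr fun t => ?_
  unfold f2 Fe; rw [Real.exp_neg]; ring

lemma vu2_tendsto (n : ℕ) :
    Filter.Tendsto (fun t => t * w2 n t * u2 n t) Filter.atTop (nhds 0) := by
  have h1 := Polynomial.tendsto_div_exp_atTop (Polynomial.X * (Polynomial.C (-((-1:ℝ)^n)) * LagP n))
  have h2 := Polynomial.tendsto_div_exp_atTop (Polynomial.C (-((-1:ℝ)^n)) *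
    ((1 - Polynomial.X) * LagP n + Polynomial.X * Polynomial.derivative (LagP n)))
  have h3 := h1.mul h2
  rw [mul_zero] at h3
  refine h3.congr fun t => ?_
  simp only [w2, u2, Le, Ld, Polynomial.eval_mul, Polynomial.eval_add, Polynomial.eval_sub,
    Polynomial.eval_one, Polynomial.eval_X, Polynomial.eval_C]
  rw [Real.exp_neg]; ring

open MeasureTheory
open scoped ENNReal NNReal

/-! Part 4: two-dimensional bounds via a Lyapunov function -/

structure OdeSys (l g : ℝ) (f w w' u : ℝ → ℝ) : Prop where
  hg : 3 ≤ g
  hl : l = g ^ 3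
  hf : ∀ t, HasDerivAt f (w t) t
  hw : ∀ t, HasDerivAt w (w' t) t
  hwu : ∀ t, w t + t * w' t = u t
  hu : ∀ t, HasDerivAt u (-(l - t) * w t) t
  h0 : l * f 0 + u 0 = l / 2
  hu0 : u 0 ^ 2 = l ^ 2 / 4
  nn : ∀ t, 0 ≤ t → 0 ≤ f t

lemma ineq_R {l c t : ℝ} (hl : 27 ≤ l) (hc : 6 ≤ c) (hc3 : c ^ 3 = 8 * l) (ht : 0 < t) (htl : t ≤ l) :
    -(1 / l * (l - t) / (t ^ 2 * (t + 1 / l)) + c / (t * (l + c - t)))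
      + 3 / 16 * (1 / (t + 1 / l)) ^ 3 - 3 / 16 * (1 / (t + 1 / l)) ^ 2 * (1 / (l + c - t))
      + 9 / 16 * (1 / (t + 1 / l)) * (1 / (l + c - t)) ^ 2 + 15 / 16 * (1 / (l + c - t)) ^ 3 ≤ 0 := by
  have hl0 : 0 < l := by linarith
  set T := t + 1 / l with hT
  set s := l + c - t with hs
  have hs0 : c ≤ s := by linarith
  have hs1 : 0 < s := by linarith
  have hT0 : t ≤ T := by have : 0 < 1 / l := by positivity
                         linarith
  have hT1 : 0 < T := by linarith
  have e1 : 0 ≤ 3 / 16 * (1 / T) ^ 2 * (1 / s) := by positivity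
  have e2 : 9 / 16 * (1 / T) * (1 / s) ^ 2 ≤ c / (4 * (t * s)) := by
    have : 9 / 16 * (1 / T) * (1 / s) ^ 2 = 9 / (16 * T * s ^ 2) := by field_simp
    rw [this, div_le_div_iff₀ (by positivity) (by positivity)]
    have : 9 ≤ c * s := by nlinarith
    have h1 : t * s ≤ T * s := by gcongr
    have h2 : 0 < t * s := by positivity
    calc 9 * (4 * (t * s)) ≤ (c * s) * (16 * (T * s)) := by nlinarith
      _ = _ := by ring
  have e3 : 15 / 16 * (1 / s) ^ 3 ≤ c / (4 * (t * s)) := by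
    have : 15 / 16 * (1 / s) ^ 3 = 15 / (16 * s ^ 3) := by field_simp
    rw [this, div_le_div_iff₀ (by positivity) (by positivity)]
    have h1 : c * c ^ 2 ≤ c * s ^ 2 := by gcongr
    have h2 : 15 * t ≤ 4 * (c * s ^ 2) := by nlinarith
    calc 15 * (4 * (t * s)) = (15 * t) * (4 * s) := by ring
      _ ≤ (4 * (c * s ^ 2)) * (4 * s) := by gcongr
      _ = _ := by ring
  have e4 : 3 / 16 * (1 / T) ^ 3 ≤ 1 / l * (l - t) / (t ^ 2 * T) + c / (2 * (t * s)) := by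
    have : 3 / 16 * (1 / T) ^ 3 = 3 / (16 * T ^ 3) := by field_simp
    rw [this]
    rcases le_total t (l / 2) with h | h
    · have a1 : 0 ≤ c / (2 * (t * s)) := by positivity
      have a2 : 1 / 2 ≤ 1 / l * (l - t) := by
        rw [div_mul_eq_mul_div, one_mul, le_div_iff₀ hl0]; linarith
      have a3 : 3 / (16 * T ^ 3) ≤ (1 / 2) / (t ^ 2 * T) := by
        rw [div_le_div_iff₀ (by positivity) (by positivity)]
        have : t ^ 2 * T ≤ T ^ 2 * T := by gcongr
        have : 0 < T ^ 3 := by positivity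
        nlinarith
      have a4 : (1 / 2) / (t ^ 2 * T) ≤ 1 / l * (l - t) / (t ^ 2 * T) := by gcongr
      linarith
    · have a1 : 0 ≤ 1 / l * (l - t) / (t ^ 2 * T) := by
        have : 0 ≤ l - t := by linarith
        positivity
      have a3 : 3 / (16 * T ^ 3) ≤ 3 / (16 * t ^ 3) := by gcongr
      have a4 : 3 / (16 * t ^ 3) ≤ c / (2 * (t * s)) := by
        rw [div_le_div_iff₀ (by positivity) (by positivity)]
        have h1 : s ≤ 2 * c * t := by nlinarith
        have h2 : 1 ≤ t := by linarith
        have h3 : s ≤ 2 * c * t ^ 2 := by nlinarith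
        calc 3 * (2 * (t * s)) = 6 * t * s := by ring
          _ ≤ 6 * t * (2 * c * t ^ 2) := by gcongr
          _ ≤ c * (16 * t ^ 3) := by
            have : 0 < c * t ^ 3 := by positivity
            nlinarith
      linarith
  have e5 : c / (t * s) = c / (2 * (t * s)) + c / (4 * (t * s)) + c / (4 * (t * s)) := by
    field_simp; ring
  linarith

lemma ineq_coer {l c t : ℝ} (hl : 27 ≤ l) (hc : 6 ≤ c) (hc2 : c ≤ l / 4) (ht : 0 < t) (htl : t ≤ l) :
    1 / 4 * (1 / (t + 1 / l)) ^ 2 ≤ 1 / 2 * ((l - t) / t) + 1 / 8 * (1 / (l + c - t)) ^ 2 := by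
  have hl0 : 0 < l := by linarith
  have hd : 0 < 1 / l := by positivity
  have hs : 0 < l + c - t := by linarith
  have hT : 0 < t + 1 / l := by linarith
  have n2 : 0 ≤ 1 / 8 * (1 / (l + c - t)) ^ 2 := by positivity
  rcases le_total t (l / 2) with h | h
  · have : (1 / (t + 1 / l)) ^ 2 ≤ l / (4 * t) := by
      rw [div_pow, one_pow, div_le_div_iff₀ (by positivity) (by positivity)]
      have e : l * (1 / l) = 1 := by field_simp
      have : 0 ≤ l * (t - 1 / l) ^ 2 := by positivity
      nlinarith
    have h2 : l / (4 * t) / 4 ≤ 1 / 2 * ((l - t) / t) := by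
      rw [div_div, mul_div_assoc', div_le_div_iff₀ (by positivity) (by positivity)]
      nlinarith
    linarith
  · have a : (1 / (t + 1 / l)) ^ 2 ≤ (1 / t) ^ 2 := by gcongr; linarith
    rcases le_total t (3 / 4 * l) with h' | h'
    · have h2 : 1 / 3 ≤ (l - t) / t := by
        rw [div_le_div_iff₀ (by positivity) (by positivity)]; linarith
      have h3 : (1 / t) ^ 2 ≤ (1 / 13) ^ 2 := by gcongr; linarith
      linarith
    · have h2 : 0 ≤ (l - t) / t := div_nonneg (by linarith) ht.le
      have h3 : (1 / t) ^ 2 ≤ 1 / 2 * (1 / (l + c - t)) ^ 2 := by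
        rw [div_pow, div_pow, one_pow, mul_one_div, div_le_div_iff₀ (by positivity) (by positivity)]
        nlinarith
      linarith

variable {l g : ℝ} {f w w' u : ℝ → ℝ}

lemma OdeSys.bl (S : OdeSys l g f w w' u) : 27 ≤ l ∧ 6 ≤ 2 * g ∧ (2 * g) ^ 3 = 8 * l ∧ 2 * g ≤ l / 4 := by
  have := S.hg
  rw [S.hl]
  refine ⟨?_, by linarith, by ring, ?_⟩
  · calc (27:ℝ) = 3 ^ 3 := by norm_num
      _ ≤ _ := by gcongr
  · nlinarith [mul_self_nonneg (g - 3)]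

lemma OdeSys.hv (S : OdeSys l g f w w' u) (t : ℝ) : HasDerivAt (fun t => t * w t) (u t) t := by
  refine ((hasDerivAt_id t).mul (S.hw t)).congr_deriv ?_
  have := S.hwu t
  simp only [id]; linarith

noncomputable def mfun (l c t : ℝ) : ℝ := Real.exp ((Real.log (t + 1 / l) - Real.log (l + c - t)) / 2)

lemma mfun_sq {l c t : ℝ} (hT : 0 < t + 1 / l) (hs : 0 < l + c - t) :
    mfun l c t ^ 2 = (t + 1 / l) / (l + c - t) := by
  unfold mfun
  rw [← Real.exp_nat_mul]
  rw [show ((2:ℕ):ℝ) * ((Real.log (t + 1 / l) - Real.log (l + c - t)) / 2) =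
    Real.log (t + 1 / l) - Real.log (l + c - t) by push_cast; ring]
  rw [Real.exp_sub, Real.exp_log hT, Real.exp_log hs]

lemma mfun_deriv {l c t : ℝ} (hT : 0 < t + 1 / l) (hs : 0 < l + c - t) :
    HasDerivAt (mfun l c) (mfun l c t * (1 / 2 * (1 / (t + 1 / l) + 1 / (l + c - t)))) t := by
  have h1 : HasDerivAt (fun t => t + 1 / l) 1 t := (hasDerivAt_id t).add_const _
  have h2 : HasDerivAt (fun t => l + c - t) (-1) t := (hasDerivAt_id t).const_sub _
  refine (((h1.log hT.ne').sub (h2.log hs.ne')).div_const 2).exp.congr_deriv ?_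
  simp only [mfun, Pi.sub_apply]
  ring

noncomputable def Lam (l c : ℝ) (w u : ℝ → ℝ) (t : ℝ) : ℝ :=
  u t ^ 2 - 1 / 2 * (1 / (t + 1 / l) + 1 / (l + c - t)) * (t * w t) * u t + (l - t) * t * w t ^ 2
    + 1 / 2 * (-(1 / 4) * (1 / (t + 1 / l)) ^ 2 + 1 / 2 * (1 / (t + 1 / l)) * (1 / (l + c - t))
      + 3 / 4 * (1 / (l + c - t)) ^ 2) * (t * w t) ^ 2

lemma Lam_deriv (S : OdeSys l g f w w' u) {c t : ℝ} (hT : 0 < t + 1 / l) (hs : 0 < l + c - t)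
    (ht : 0 < t) (hl : 0 < l) :
    HasDerivAt (fun t => mfun l c t * Lam l c w u t)
      (mfun l c t * (-(1 / l * (l - t) / (t ^ 2 * (t + 1 / l)) + c / (t * (l + c - t)))
      + 3 / 16 * (1 / (t + 1 / l)) ^ 3 - 3 / 16 * (1 / (t + 1 / l)) ^ 2 * (1 / (l + c - t))
      + 9 / 16 * (1 / (t + 1 / l)) * (1 / (l + c - t)) ^ 2 + 15 / 16 * (1 / (l + c - t)) ^ 3)
        * (t * w t) ^ 2) t := by
  have hiT : HasDerivAt (fun t => 1 / (t + 1 / l)) (-(1 / (t + 1 / l)) ^ 2) t := by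
    have h1 : HasDerivAt (fun t => t + 1 / l) 1 t := (hasDerivAt_id t).add_const _
    simp only [one_div] at h1 hT ⊢
    refine (h1.inv hT.ne').congr_deriv ?_
    field_simp
  have his : HasDerivAt (fun t => 1 / (l + c - t)) ((1 / (l + c - t)) ^ 2) t := by
    have h2 : HasDerivAt (fun t => l + c - t) (-1) t := (hasDerivAt_id t).const_sub _
    simp only [one_div]
    refine (h2.inv hs.ne').congr_deriv ?_
    field_simp
  have hlt : HasDerivAt (fun t => (l - t) * t) (l - 2 * t) t := by
    refine (((hasDerivAt_id t).const_sub l).mul (hasDerivAt_id t)).congr_deriv ?_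
    simp only [id]; ring
  have hv := S.hv t
  have hu := S.hu t
  have hw := S.hw t
  have hq := ((((hu.pow 2).sub ((((hiT.add his).const_mul (1/2)).mul hv).mul hu)).add
    (hlt.mul (hw.pow 2))).add
    ((((((hiT.pow 2).const_mul (-(1/4))).add ((hiT.const_mul (1/2)).mul his)).add
      ((his.pow 2).const_mul (3/4))).const_mul (1/2)).mul (hv.pow 2)))
  refine ((mfun_deriv hT hs).mul hq).congr_deriv ?_
  have hwu : w' t = (u t - w t) / t := by
    have := S.hwu t
    field_simp; linarith
  simp only [Pi.add_apply, Pi.mul_apply, Pi.sub_apply, Pi.pow_apply, hwu]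
  generalize mfun l c t = m
  generalize u t = uu
  generalize w t = ww
  have hc : c = (l + c - t) - l + t := by ring
  have hD : 1 / l = (t + 1 / l) - t := by ring
  generalize hse : l + c - t = s at *
  generalize hTe : t + 1 / l = T at *
  rw [hD, hc]
  have hT' := hT.ne'
  have ht' := ht.ne'
  have hs' := hs.ne'
  clear hq hv hw hu hlt his hiT
  push_cast
  field_simp
  ring

open MeasureTheory
open scoped ENNReal NNReal

lemma Lam_le {l g : ℝ} {f w w' u : ℝ → ℝ} (S : OdeSys l g f w w' u) {t : ℝ} (ht : 0 ≤ t) (htl : t ≤ l) :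
    mfun l (2*g) t * Lam l (2*g) w u t ≤ l / 4 := by
  obtain ⟨hl, hc, hc3, hc2⟩ := S.bl
  have hl0 : 0 < l := by linarith
  have hd : 0 < 1 / l := by positivity
  have hanti : AntitoneOn (fun t => mfun l (2*g) t * Lam l (2*g) w u t) (Set.Icc 0 l) := by
    have hwc : Continuous w := continuous_iff_continuousAt.2 fun t => (S.hw t).continuousAt
    have huc : Continuous u := continuous_iff_continuousAt.2 fun t => (S.hu t).continuousAt
    apply antitoneOn_of_deriv_nonpos (convex_Icc 0 l)
    · intro x hx
      have h1 : x + 1 / l ≠ 0 := by have := hx.1; positivity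
      have h2 : l + 2 * g - x ≠ 0 := by have := hx.2; intro h; linarith
      apply ContinuousAt.continuousWithinAt
      apply ContinuousAt.mul
      · refine (mfun_deriv ?_ ?_).continuousAt
        · have := hx.1; positivity
        · have := hx.2; linarith
      · unfold Lam
        have c1 : ContinuousAt (fun t => 1 / (t + 1 / l)) x :=
          continuousAt_const.div (by fun_prop) h1
        have c2 : ContinuousAt (fun t => 1 / (l + 2 * g - t)) x :=
          continuousAt_const.div (by fun_prop) h2
        have c3 := hwc.continuousAt (x := x)
        have c4 := huc.continuousAt (x := x)
        fun_prop
    · intro x hx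
      rw [interior_Icc] at hx
      have := hx.1
      exact (Lam_deriv S (by positivity) (by linarith [hx.2]) hx.1 hl0).differentiableAt.differentiableWithinAt
    · intro x hx
      rw [interior_Icc] at hx
      have := hx.1
      rw [(Lam_deriv S (by positivity) (by linarith [hx.2]) hx.1 hl0).deriv]
      have hR := ineq_R hl hc hc3 hx.1 hx.2.le
      have hm : 0 < mfun l (2*g) x := Real.exp_pos _
      apply mul_nonpos_of_nonpos_of_nonneg _ (sq_nonneg _)
      exact mul_nonpos_of_nonneg_of_nonpos hm.le hR
  have h := hanti (Set.left_mem_Icc.2 hl0.le) ⟨ht, htl⟩ ht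
  refine h.trans ?_
  simp only [Lam]
  simp only [zero_mul, mul_zero, sub_zero, zero_add, add_zero, S.hu0, ne_eq, OfNat.ofNat_ne_zero,
    not_false_eq_true, zero_pow]
  have hm : 0 < mfun l (2*g) 0 := Real.exp_pos _
  have hm2 : mfun l (2*g) 0 ^ 2 ≤ (1 / l) ^ 2 := by
    rw [mfun_sq (by simpa using hl0) (by linarith)]
    rw [zero_add, sub_zero, one_div_pow, div_div]
    apply one_div_le_one_div_of_le (by positivity)
    nlinarith
  have hm3 : mfun l (2*g) 0 ≤ 1 / l := by
    exact (sq_le_sq₀ hm.le hd.le).1 hm2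
  calc mfun l (2*g) 0 * (l ^ 2 / 4) ≤ 1 / l * (l ^ 2 / 4) := by gcongr
    _ = l / 4 := by field_simp

lemma OdeSys.main {l g : ℝ} {f w w' u : ℝ → ℝ} (S : OdeSys l g f w w' u) {t : ℝ} (ht : 0 < t) (htl : t ≤ l) :
    ∃ μ : ℝ, 0 < μ ∧ μ ^ 2 = (l + 2 * g - t) / (t + 1 / l) ∧ u t ^ 2 ≤ l / 2 * μ ∧
      ((l - t) / t + 1 / 4 * (1 / (l + 2 * g - t)) ^ 2) * (t * w t) ^ 2 ≤ l / 2 * μ := by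
  obtain ⟨hl, hc, hc3, hc2⟩ := S.bl
  have hl0 : 0 < l := by linarith
  have hd : 0 < 1 / l := by positivity
  have h := Lam_le S ht.le htl
  have hT : 0 < t + 1 / l := by linarith
  have hs : 0 < l + 2 * g - t := by linarith
  have hm : 0 < mfun l (2*g) t := Real.exp_pos _
  have hm2 := mfun_sq hT hs
  have hco := ineq_coer hl hc hc2 ht htl
  have hL : Lam l (2*g) w u t ≤ l / 4 * (mfun l (2*g) t)⁻¹ := by
    rw [← div_eq_mul_inv, le_div_iff₀ hm]; linarith
  have hq : 0 ≤ (l - t) / t := div_nonneg (by linarith) ht.le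
  have hge : 1 / 2 * u t ^ 2 + 1 / 2 * (((l - t) / t + 1 / 4 * (1 / (l + 2 * g - t)) ^ 2) * (t * w t) ^ 2)
      ≤ Lam l (2*g) w u t := by
    have e : (l - t) * t * w t ^ 2 = (l - t) / t * (t * w t) ^ 2 := by field_simp
    unfold Lam
    rw [e]
    generalize t * w t = v at *
    generalize u t = uu at *
    generalize 1 / (t + 1 / l) = a at *
    generalize 1 / (l + 2 * g - t) = b at *
    generalize (l - t) / t = q at *
    have h1 := sq_nonneg (uu - 1 / 2 * (a + b) * v)
    have h2 := mul_le_mul_of_nonneg_right hco (sq_nonneg v)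
    nlinarith
  refine ⟨(mfun l (2*g) t)⁻¹, by positivity, ?_, ?_, ?_⟩
  · rw [inv_pow, hm2, inv_div]
  · have : 0 ≤ 1 / 2 * (((l - t) / t + 1 / 4 * (1 / (l + 2 * g - t)) ^ 2) * (t * w t) ^ 2) := by positivity
    linarith
  · have : 0 ≤ 1 / 2 * u t ^ 2 := by positivity
    linarith

lemma OdeSys.low {l g : ℝ} {f w w' u : ℝ → ℝ} (S : OdeSys l g f w w' u) {t : ℝ} (ht : 0 ≤ t) (htl : t ≤ l / 2) :
    |u t| ≤ l ∧ |t * w t| ≤ l := by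
  obtain ⟨hl, hc, hc3, hc2⟩ := S.bl
  have hl0 : 0 < l := by linarith
  have hd : 0 < 1 / l := by positivity
  rcases ht.eq_or_lt with h | h
  · subst h
    refine ⟨?_, by simpa using hl0.le⟩
    apply abs_le_of_sq_le_sq _ hl0.le
    rw [S.hu0]; nlinarith
  · obtain ⟨μ, hμ, hμ2, h1, h2⟩ := S.main h (by linarith)
    have hq : 1 ≤ (l - t) / t := by rw [le_div_iff₀ h]; linarith
    have hs : 0 < l + 2 * g - t := by linarith
    have hμl : μ ≤ 2 * l := by
      apply le_of_sq_le_sq _ (by positivity)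
      rw [hμ2, div_le_iff₀ (by positivity)]
      have : l * (1 / l) = 1 := by field_simp
      nlinarith
    constructor
    · apply abs_le_of_sq_le_sq _ hl0.le
      nlinarith
    · apply abs_le_of_sq_le_sq _ hl0.le
      have : 0 ≤ 1 / 4 * (1 / (l + 2 * g - t)) ^ 2 := by positivity
      have h3 : 1 * (t * w t) ^ 2 ≤ ((l - t) / t + 1 / 4 * (1 / (l + 2 * g - t)) ^ 2) * (t * w t) ^ 2 := by
        gcongr; linarith
      nlinarith

lemma OdeSys.high {l g : ℝ} {f w w' u : ℝ → ℝ} (S : OdeSys l g f w w' u) {t : ℝ} (ht : l / 2 ≤ t) (htl : t ≤ l) :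
    |u t| ≤ √g * √(l + 2 * g - t) ∧ |t * w t| ≤ 12 * g ^ 2 := by
  obtain ⟨hl, hc, hc3, hc2⟩ := S.bl
  have hl0 : 0 < l := by linarith
  have hd : 0 < 1 / l := by positivity
  have hg := S.hg
  have hlg := S.hl
  have ht0 : 0 < t := by linarith
  obtain ⟨μ, hμ, hμ2, h1, h2⟩ := S.main ht0 htl
  have hsc : 2 * g ≤ l + 2 * g - t := by linarith
  have hst : t = l + 2 * g - (l + 2 * g - t) := by ring
  generalize hse : l + 2 * g - t = s at *
  have hs : 0 < s := by linarith
  have hsl : s ≤ l := by linarith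
  have hμ3 : μ ^ 2 ≤ 2 * s / l := by
    rw [hμ2, div_le_div_iff₀ (by positivity) hl0]
    nlinarith
  have hμl : l * μ ^ 2 ≤ 2 * s := by
    rw [le_div_iff₀ hl0] at hμ3; linarith
  constructor
  · rw [← Real.sqrt_mul (by linarith)]
    apply Real.abs_le_sqrt
    refine h1.trans ?_
    apply le_of_sq_le_sq _ (by positivity)
    have e1 : (l / 2 * μ) ^ 2 = l / 4 * (l * μ ^ 2) := by ring
    rw [e1]
    have e2 : l / 4 * (l * μ ^ 2) ≤ l / 4 * (2 * s) := by gcongr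
    refine e2.trans ?_
    rw [hlg]
    have : 2 * (g * (g ^ 2 * s)) ≤ g ^ 2 * s * s := by
      have : 0 < g ^ 2 * s := by positivity
      nlinarith
    nlinarith
  · apply abs_le_of_sq_le_sq _ (by positivity)
    have hq : s / (256 * l) ≤ (l - t) / t + 1 / 4 * (1 / s) ^ 2 := by
      have q0 : 0 ≤ (l - t) / t := div_nonneg (by linarith) ht0.le
      rcases le_total s (4 * g) with h | h
      · have : s / (256 * l) ≤ 1 / 4 * (1 / s) ^ 2 := by
          rw [one_div_pow, mul_one_div, div_div, div_le_div_iff₀ (by positivity) (by positivity)]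
          have : s ^ 3 ≤ (4 * g) ^ 3 := by gcongr
          rw [hlg]; nlinarith
        linarith
      · have : s / (256 * l) ≤ (l - t) / t := by
          rw [div_le_div_iff₀ (by positivity) (by positivity)]
          have h3 : s / 2 ≤ l - t := by linarith
          have h4 : s * t ≤ s * l := by gcongr
          have h5 : s / 2 * (256 * l) ≤ (l - t) * (256 * l) := by gcongr
          have : 0 < s * l := by positivity
          nlinarith
        have : 0 ≤ 1 / 4 * (1 / s) ^ 2 := by positivity
        linarith
    have h3 : s / (256 * l) * (t * w t) ^ 2 ≤ l / 2 * μ :=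
      (mul_le_mul_of_nonneg_right hq (sq_nonneg _)).trans h2
    have h4 : s * (t * w t) ^ 2 ≤ 128 * l ^ 2 * μ := by
      rw [div_mul_eq_mul_div, div_le_iff₀ (by positivity)] at h3
      nlinarith
    have h5 : g ^ 2 * μ ≤ s := by
      apply le_of_sq_le_sq _ hs.le
      have : g ^ 3 * μ ^ 2 ≤ 2 * s := by rw [← hlg]; exact hμl
      calc (g ^ 2 * μ) ^ 2 = g * (g ^ 3 * μ ^ 2) := by ring
        _ ≤ g * (2 * s) := by gcongr
        _ ≤ s ^ 2 := by nlinarith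
    have h6 : s * (t * w t) ^ 2 ≤ s * (128 * g ^ 4) := by
      refine h4.trans ?_
      rw [hlg]
      calc 128 * (g ^ 3) ^ 2 * μ = 128 * g ^ 4 * (g ^ 2 * μ) := by ring
        _ ≤ 128 * g ^ 4 * s := by gcongr
        _ = _ := by ring
    have h7 := le_of_mul_le_mul_left h6 hs
    have : 0 < g ^ 4 := by positivity
    nlinarith

open MeasureTheory
open scoped ENNReal NNReal

noncomputable def Gf (l g t : ℝ) : ℝ := t / (l + 2 * g - t) + 2 * g * t / (l + 2 * g - t) ^ 2
noncomputable def Gf' (l g t : ℝ) : ℝ := (l + 4 * g) / (l + 2 * g - t) ^ 2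
  + 4 * g * t / (l + 2 * g - t) ^ 3

lemma Y_deriv {l g : ℝ} {f w w' u : ℝ → ℝ} (S : OdeSys l g f w w' u) {t : ℝ} (hs : 0 < l + 2 * g - t) :
    HasDerivAt (fun t => l * f t + u t * (1 + Gf l g t))
      (Gf' l g t * u t + (2 * g / (l + 2 * g - t)) ^ 2 * (t * w t)) t := by
  have h2 : HasDerivAt (fun t => l + 2 * g - t) (-1) t := (hasDerivAt_id t).const_sub _
  have hG : HasDerivAt (Gf l g) (Gf' l g t) t := by
    have h1 := ((hasDerivAt_id t).div h2 hs.ne').add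
      (((hasDerivAt_id t).const_mul (2 * g)).div (h2.pow 2) (pow_ne_zero 2 hs.ne'))
    refine h1.congr_deriv ?_
    unfold Gf'
    simp only [id, Pi.pow_apply]
    have := hs.ne'
    have hl : l = (l + 2 * g - t) - 2 * g + t := by ring
    generalize l + 2 * g - t = s at *
    subst hl
    push_cast
    field_simp
    ring
  refine (((S.hf t).const_mul l).add ((S.hu t).mul (hG.const_add 1))).congr_deriv ?_
  unfold Gf Gf'
  have := hs.ne'
  have hl : l = (l + 2 * g - t) - 2 * g + t := by ring
  generalize l + 2 * g - t = s at *
  subst hl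
  generalize u t = uu
  generalize w t = ww
  field_simp
  ring

lemma Gf'_bound {l g t : ℝ} (hl : 27 ≤ l) (hg : 3 ≤ g) (hc : 2 * g ≤ l / 4) (ht : 0 ≤ t) (htl : t ≤ l) :
    0 ≤ Gf' l g t ∧ Gf' l g t ≤ 4 * l / (l + 2 * g - t) ^ 2 := by
  unfold Gf'
  have hs : 2 * g ≤ l + 2 * g - t := by linarith
  generalize l + 2 * g - t = s at *
  have hs0 : 0 < s := by linarith
  refine ⟨by positivity, ?_⟩
  have : 4 * g * t / s ^ 3 ≤ 2 * l / s ^ 2 := by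
    rw [div_le_div_iff₀ (by positivity) (by positivity)]
    have : (2 * g) * t ≤ s * l := by gcongr
    have : 0 < s ^ 2 := by positivity
    nlinarith
  calc (l + 4 * g) / s ^ 2 + 4 * g * t / s ^ 3 ≤ (2 * l) / s ^ 2 + 2 * l / s ^ 2 := by
        gcongr; linarith
    _ = _ := by ring

lemma Gf_bound {l g t : ℝ} (hg : 3 ≤ g) (ht : 0 ≤ t) (htl : t ≤ l) :
    0 ≤ Gf l g t ∧ Gf l g t ≤ 2 * t / (l + 2 * g - t) := by
  unfold Gf
  have hs : 2 * g ≤ l + 2 * g - t := by linarith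
  generalize l + 2 * g - t = s at *
  have hs0 : 0 < s := by linarith
  refine ⟨by positivity, ?_⟩
  have : 2 * g * t / s ^ 2 ≤ t / s := by
    rw [div_le_div_iff₀ (by positivity) (by positivity)]
    have : (2 * g) * t ≤ s * t := by gcongr
    nlinarith
  calc t / s + 2 * g * t / s ^ 2 ≤ t / s + t / s := by gcongr
    _ = _ := by ring

lemma Y_low {l g : ℝ} {f w w' u : ℝ → ℝ} (S : OdeSys l g f w w' u) {t : ℝ} (ht : 0 ≤ t) (htl : t ≤ l / 2) :
    |l * f t + u t * (1 + Gf l g t) - l / 2| ≤ 32 * t := by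
  obtain ⟨hl, hc, hc3, hc2⟩ := S.bl
  have hl0 : 0 < l := by linarith
  have hg := S.hg
  have hlg := S.hl
  have h := mvt_bound (Z := fun t => 32 * t) (Z' := fun _ => 32) ht
    (fun x hx => Y_deriv S (by linarith [hx.2]))
    (fun x _ => by simpa using (hasDerivAt_id x).const_mul (32:ℝ)) (fun x hx => ?_)
  · have : l * f 0 + u 0 * (1 + Gf l g 0) = l / 2 := by
      rw [← S.h0]; simp [Gf]
    simp only [this, mul_zero, sub_zero] at h
    exact h
  · obtain ⟨hx0, hx1⟩ := hx
    obtain ⟨b1, b2⟩ := S.low hx0 (by linarith)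
    obtain ⟨g1, g2⟩ := Gf'_bound hl hg hc2 hx0 (by linarith : x ≤ l)
    have hs : l / 2 ≤ l + 2 * g - x := by linarith
    generalize l + 2 * g - x = s at *
    have hs0 : 0 < s := by linarith
    have g3 : Gf' l g x ≤ 16 / l := by
      refine g2.trans ?_
      rw [div_le_div_iff₀ (by positivity) hl0]
      have : (l / 2) ^ 2 ≤ s ^ 2 := by gcongr
      nlinarith
    have c3 : (2 * g / s) ^ 2 ≤ 16 / l := by
      rw [div_pow, div_le_div_iff₀ (by positivity) hl0]
      have : (l / 2) ^ 2 ≤ s ^ 2 := by gcongr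
      have h1 : g ^ 2 * g ≤ l := by rw [hlg]; apply le_of_eq; ring
      have h2 : g ^ 2 ≤ l := by nlinarith [sq_nonneg g]
      have h3 : (2 * g) ^ 2 * l ≤ 4 * l * l := by nlinarith
      nlinarith
    calc |Gf' l g x * u x + (2 * g / s) ^ 2 * (x * w x)|
        ≤ |Gf' l g x * u x| + |(2 * g / s) ^ 2 * (x * w x)| := abs_add_le _ _
      _ = Gf' l g x * |u x| + (2 * g / s) ^ 2 * |x * w x| := by
          rw [abs_mul, abs_mul (_ ^ 2), abs_of_nonneg g1, abs_of_nonneg (sq_nonneg (2 * g / s))]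
      _ ≤ 16 / l * l + 16 / l * l := by gcongr
      _ = 32 := by field_simp; norm_num

lemma f_low {l g : ℝ} {f w w' u : ℝ → ℝ} (S : OdeSys l g f w w' u) (hl' : 331776 ≤ l)
    {t : ℝ} (ht : 1 ≤ t) (htl : t ≤ l / 256) : 1 / 4 ≤ f t := by
  have hl0 : 0 < l := by linarith
  have hg := S.hg
  have h := Y_low S (by linarith : 0 ≤ t) (by linarith)
  obtain ⟨μ, hμ, hμ2, h1, h2⟩ := S.main (by linarith : 0 < t) (by linarith)
  obtain ⟨hl, hc, hc3, hc2⟩ := S.bl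
  have hd : 0 < 1 / l := by positivity
  have hs : l / 2 ≤ l + 2 * g - t := by linarith
  have hμ3 : μ ^ 2 ≤ 2 * l := by
    rw [hμ2, div_le_iff₀ (by linarith)]
    nlinarith
  obtain ⟨g1, g2⟩ := Gf_bound hg (by linarith : 0 ≤ t) (by linarith : t ≤ l)
  have g3 : Gf l g t ≤ 1 := by
    refine g2.trans ?_
    rw [div_le_one (by linarith)]; linarith
  have hu : |u t| ≤ l / 16 := by
    apply abs_le_of_sq_le_sq _ (by positivity)
    refine h1.trans ?_
    have : μ ≤ l / 128 := by
      apply le_of_sq_le_sq _ (by positivity)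
      nlinarith
    nlinarith
  have h5 : |u t * (1 + Gf l g t)| ≤ l / 8 := by
    rw [abs_mul, abs_of_nonneg (by linarith : 0 ≤ 1 + Gf l g t)]
    have : |u t| * (1 + Gf l g t) ≤ l / 16 * 2 := by gcongr; linarith
    linarith
  rw [abs_le] at h h5
  nlinarith

lemma f_up_mid {l g : ℝ} {f w w' u : ℝ → ℝ} (S : OdeSys l g f w w' u)
    {t : ℝ} (ht : 0 ≤ t) (htl : t ≤ l) : f t ≤ 60 := by
  obtain ⟨hl, hc, hc3, hc2⟩ := S.bl
  have hl0 : 0 < l := by linarith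
  have hg := S.hg
  have hlg := S.hl
  obtain ⟨g1, g2⟩ := Gf_bound hg ht htl
  rcases le_total t (l / 2) with h | h
  · have hY := Y_low S ht h
    obtain ⟨b1, b2⟩ := S.low ht h
    have g3 : Gf l g t ≤ 2 := by
      refine g2.trans ?_
      rw [div_le_iff₀ (by linarith)]; linarith
    have h5 : |u t * (1 + Gf l g t)| ≤ l * 3 := by
      rw [abs_mul, abs_of_nonneg (by linarith : 0 ≤ 1 + Gf l g t)]
      gcongr; linarith
    rw [abs_le] at hY h5
    nlinarith
  · have hY := Y_low S (by linarith : 0 ≤ l / 2) le_rfl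
    have hm := mvt_bound (G := fun t => l * f t + u t * (1 + Gf l g t))
      (Z := fun t => 8 * l * √g / √(l + 2 * g - t) + 48 * g ^ 4 / (l + 2 * g - t))
      (Z' := fun t => 4 * l * √g / (√(l + 2 * g - t) * (l + 2 * g - t)) + 48 * g ^ 4 / (l + 2 * g - t) ^ 2) h
      (fun x hx => Y_deriv S (by linarith [hx.2]))
      (fun x hx => ?_) (fun x hx => ?_)
    · have hs : 2 * g ≤ l + 2 * g - t := by linarith
      have hsl : l + 2 * g - t ≤ l := by linarith
      have z1 : 8 * l * √g / √(l + 2 * g - t) ≤ 8 * l := by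
        rw [div_le_iff₀ (Real.sqrt_pos.2 (by linarith))]
        gcongr; linarith
      have z2 : 48 * g ^ 4 / (l + 2 * g - t) ≤ 24 * l := by
        rw [div_le_iff₀ (by linarith)]
        calc 48 * g ^ 4 = 24 * g ^ 3 * (2 * g) := by ring
          _ ≤ 24 * g ^ 3 * (l + 2 * g - t) := by gcongr
          _ = _ := by rw [← hlg]
      have z3 : 0 ≤ 8 * l * √g / √(l + 2 * g - l / 2) + 48 * g ^ 4 / (l + 2 * g - l / 2) := by
        have : 0 < l + 2 * g - l / 2 := by linarith
        positivity
      obtain ⟨b1, b2⟩ := S.high h htl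
      have h5 : |u t * (1 + Gf l g t)| ≤ 3 * l := by
        rw [abs_mul, abs_of_nonneg (by linarith : 0 ≤ 1 + Gf l g t)]
        have hgs : √g ≤ √(l + 2 * g - t) := Real.sqrt_le_sqrt (by linarith)
        have hgG : 1 + Gf l g t ≤ 3 * l / (l + 2 * g - t) := by
          have : 1 + 2 * t / (l + 2 * g - t) ≤ 3 * l / (l + 2 * g - t) := by
            rw [le_div_iff₀ (by linarith), add_mul, div_mul_cancel₀ _ (by linarith : l + 2 * g - t ≠ 0)]
            linarith
          linarith
        have hsp : 0 < l + 2 * g - t := by linarith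
        calc |u t| * (1 + Gf l g t) ≤ (√(l + 2 * g - t) * √(l + 2 * g - t)) * (3 * l / (l + 2 * g - t)) := by
              gcongr
              exact b1.trans (by gcongr)
          _ = 3 * l := by rw [Real.mul_self_sqrt hsp.le]; field_simp
      rw [abs_le] at hm hY h5
      nlinarith
    · have hs : 0 < l + 2 * g - x := by linarith [hx.2]
      have h2 : HasDerivAt (fun t => l + 2 * g - t) (-1) x := (hasDerivAt_id x).const_sub _
      have hq := Real.sqrt_pos.2 hs
      refine (((hasDerivAt_const x (8 * l * √g)).div (h2.sqrt hs.ne') hq.ne').add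
        ((hasDerivAt_const x (48 * g ^ 4)).div h2 hs.ne')).congr_deriv ?_
      have e := Real.sq_sqrt hs.le
      rw [e]
      field_simp
      ring
    · obtain ⟨hx0, hx1⟩ := hx
      obtain ⟨b1, b2⟩ := S.high hx0 (by linarith)
      obtain ⟨g1, g2⟩ := Gf'_bound hl hg hc2 (by linarith : 0 ≤ x) (by linarith : x ≤ l)
      have hs : 0 < l + 2 * g - x := by linarith
      generalize l + 2 * g - x = s at *
      have hq := Real.sqrt_pos.2 hs
      have e := Real.sq_sqrt hs.le
      calc |Gf' l g x * u x + (2 * g / s) ^ 2 * (x * w x)|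
          ≤ |Gf' l g x * u x| + |(2 * g / s) ^ 2 * (x * w x)| := abs_add_le _ _
        _ = Gf' l g x * |u x| + (2 * g / s) ^ 2 * |x * w x| := by
            rw [abs_mul, abs_mul (_ ^ 2), abs_of_nonneg g1, abs_of_nonneg (sq_nonneg (2 * g / s))]
        _ ≤ 4 * l / s ^ 2 * (√g * √s) + (2 * g / s) ^ 2 * (12 * g ^ 2) := by gcongr
        _ = _ := by
            have : 4 * l / s ^ 2 * (√g * √s) = 4 * l * √g / (√s * s) := by
              rw [div_mul_eq_mul_div, div_eq_div_iff (by positivity) (by positivity)]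
              linear_combination (4 * l * √g * s) * e
            rw [this]
            ring

/-- beyond the turning point -/
lemma f_up_far {l g : ℝ} {f w w' u : ℝ → ℝ} (S : OdeSys l g f w w' u)
    (hf0 : Filter.Tendsto f Filter.atTop (nhds 0))
    (hvu0 : Filter.Tendsto (fun t => t * w t * u t) Filter.atTop (nhds 0))
    {t : ℝ} (htl : l ≤ t) : f t ≤ f l := by
  obtain ⟨hl, -, -, -⟩ := S.bl
  have hl0 : 0 < l := by linarith
  have hdvu : ∀ x, HasDerivAt (fun t => t * w t * u t) (u x ^ 2 + x * w x * (-(l - x) * w x)) x := by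
    intro x
    refine ((S.hv x).mul (S.hu x)).congr_deriv ?_
    ring
  have hmono : MonotoneOn (fun t => t * w t * u t) (Set.Ici l) := by
    apply monotoneOn_of_deriv_nonneg (convex_Ici l)
    · exact fun x _ => (hdvu x).continuousAt.continuousWithinAt
    · exact fun x _ => (hdvu x).differentiableAt.differentiableWithinAt
    · intro x hx
      rw [interior_Ici] at hx
      have hx' : l < x := hx
      rw [(hdvu x).deriv]
      have : 0 ≤ x * (x - l) * w x ^ 2 := by
        have : 0 ≤ x - l := by linarith
        have : 0 ≤ x := by linarith
        positivity
      nlinarith [sq_nonneg (u x)]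
  have hneg : ∀ x, l ≤ x → x * w x * u x ≤ 0 := by
    intro x hx
    refine ge_of_tendsto hvu0 ?_
    filter_upwards [Filter.eventually_ge_atTop x] with y hy
    exact hmono hx (hx.trans hy) hy
  have hanti : AntitoneOn (fun t => (t * w t) ^ 2) (Set.Ici l) := by
    apply antitoneOn_of_deriv_nonpos (convex_Ici l)
    · exact fun x _ => ((S.hv x).pow 2).continuousAt.continuousWithinAt
    · exact fun x _ => ((S.hv x).pow 2).differentiableAt.differentiableWithinAt
    · intro x hx
      rw [interior_Ici] at hx
      have hx' : l < x := hx
      have : HasDerivAt (fun t => (t * w t) ^ 2) _ x := (S.hv x).pow 2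
      rw [this.deriv]
      have := hneg x hx'.le
      push_cast
      simp only [pow_one, Nat.add_one_sub_one]
      linarith
  by_contra! hcon
  have hfc : Continuous f := continuous_iff_continuousAt.2 fun t => (S.hf t).continuousAt
  have hfl := S.nn l hl0.le
  have hft : 0 < f t := by linarith
  obtain ⟨b, hb⟩ := ((hf0.eventually (gt_mem_nhds hft)).and (Filter.eventually_ge_atTop t)).exists
  obtain ⟨m, hm, hmax⟩ := isCompact_Icc.exists_isMaxOn (Set.nonempty_Icc.2 (htl.trans hb.2)) hfc.continuousOn
  have hmt : f t ≤ f m := hmax ⟨htl, hb.2⟩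
  have hml : l < m := by
    rcases hm.1.eq_or_lt with h | h
    · rw [← h] at hmt; linarith
    · exact h
  have hmb : m < b := by
    rcases hm.2.eq_or_lt with h | h
    · rw [h] at hmt; linarith [hb.1]
    · exact h
  have hloc : IsLocalMax f m := hmax.isLocalMax (Icc_mem_nhds hml hmb)
  have hwm : w m = 0 := by
    rw [← (S.hf m).deriv]; exact hloc.deriv_eq_zero
  have hw0 : ∀ x, m ≤ x → w x = 0 := by
    intro x hx
    have h1 := hanti hml.le (hml.le.trans hx) hx
    simp only [hwm, mul_zero] at h1
    have h2 : (x * w x) ^ 2 = 0 := le_antisymm (by simpa using h1) (sq_nonneg _)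
    have h3 := pow_eq_zero_iff (two_ne_zero) |>.1 h2
    exact (mul_eq_zero.1 h3).resolve_left (by linarith)
  have hbm := mvt_bound (G := f) (Z := fun _ => 0) (Z' := fun _ => 0) hmb.le (fun x _ => S.hf x)
    (fun x _ => hasDerivAt_const x 0) (fun x hx => by rw [hw0 x hx.1]; simp)
  rw [sub_self] at hbm
  have := abs_nonpos_iff.1 hbm
  linarith [hb.1]

lemma f2_sys (n : ℕ) (hn : 13 ≤ n) : ∃ g, OdeSys (2 * n + 2) g (f2 n) (w2 n) (w2' n) (u2 n) := by
  have hn' : (13:ℝ) ≤ n := by exact_mod_cast hn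
  have e3 : (((2:ℝ) * n + 2) ^ ((1:ℝ)/3)) ^ 3 = 2 * n + 2 := by
    rw [← Real.rpow_natCast, ← Real.rpow_mul (by positivity)]; norm_num
  refine ⟨((2:ℝ) * n + 2) ^ ((1:ℝ)/3), ?_, e3.symm, f2_hasDeriv n, w2_hasDeriv n, ?_, u2_hasDeriv n, ?_, ?_,
    fun t ht => f2_nonneg n ht⟩
  · apply le_of_pow_le_pow_left₀ (n := 3) (by norm_num) (by positivity)
    rw [e3]; linarith
  · intro t; unfold w2 w2' u2; ring
  · rw [f2_at_zero, u2_at_zero]; ring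
  · rw [u2_at_zero]
    have : ((-1:ℝ)^n) ^ 2 = 1 := by rw [← pow_mul, mul_comm, pow_mul]; norm_num
    linear_combination (n + 1 : ℝ) ^ 2 * this

lemma f2_upper : ∃ C : ℝ, 0 < C ∧ ∀ n t, 0 ≤ t → f2 n t ≤ C := by
  refine ⟨7 ^ 13, by norm_num, fun n t ht => ?_⟩
  rcases le_or_gt 13 n with h | h
  · obtain ⟨g, S⟩ := f2_sys n h
    have : f2 n t ≤ 60 := by
      rcases le_total t (2 * n + 2) with h' | h'
      · exact f_up_mid S ht h'
      · exact (f_up_far S (f2_tendsto n) (vu2_tendsto n) h').trans (f_up_mid S (by positivity) le_rfl)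
    refine this.trans (by norm_num)
  · refine (f2_tail n ht).trans ?_
    calc (7:ℝ) ^ n * Real.exp (-t / 2) ≤ 7 ^ 13 * 1 := by
          gcongr
          · norm_num
          · rw [Real.exp_le_one_iff]; linarith
      _ = _ := by ring

lemma f2_lower (n : ℕ) (hn : 165888 ≤ n) {t : ℝ} (ht : 1 ≤ t) (htn : t ≤ n / 128) : 1 / 4 ≤ f2 n t := by
  obtain ⟨g, S⟩ := f2_sys n (by omega)
  have hn' : (165888:ℝ) ≤ n := by exact_mod_cast hn
  exact f_low S (by linarith) ht (by linarith)

open MeasureTheory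
open scoped ENNReal NNReal

/-! Part 7: induction on the dimension -/

lemma aH_upper (n : ℕ) : aH n 0 ≤ 1 / √((n:ℝ) + 1) := by
  have key : ∀ n, aH n 0 ^ 2 * (n + 1) ≤ 1 ∧ aH (n+1) 0 ^ 2 * (n + 2) ≤ 1 := by
    intro n
    induction n with
    | zero =>
      rw [aH_zero_zero, zero_add, aH_one_zero]
      constructor
      · have h1 : (1:ℝ) ≤ √Real.pi := by
          rw [Real.one_le_sqrt]; linarith [Real.pi_gt_three]
        have h2 : 1 / √Real.pi ≤ 1 := by rw [div_le_one (by linarith)]; exact h1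
        have h3 : 0 ≤ 1 / √Real.pi := by positivity
        push_cast; nlinarith
      · norm_num
    | succ n ih =>
      refine ⟨by push_cast; convert ih.2 using 2; ring, ?_⟩
      have h := aH_rec_zero n
      have hn : (0:ℝ) < n + 2 := by positivity
      have e : aH (n+2) 0 = (n+1) * aH n 0 / (n + 2) := by field_simp; linarith
      rw [show n + 1 + 1 = n + 2 from rfl, e]
      push_cast
      rw [div_pow, div_mul_eq_mul_div, div_le_one (by positivity)]
      have h1 := ih.1
      have h3 : (0:ℝ) ≤ n := by positivity
      have : (aH n 0 ^ 2 * (n + 1)) * ((n + 1) * (n + 1 + 2)) ≤ 1 * ((n + 1) * (n + 1 + 2)) := by gcongr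
      nlinarith
  have h := (key n).1
  rw [le_div_iff₀ (by positivity)]
  apply le_of_sq_le_sq _ (by norm_num)
  rw [mul_pow, Real.sq_sqrt (by positivity)]; linarith

lemma aH_lower (l : ℕ) : 1 / √(4 * (4 * (l:ℝ) + 1)) ≤ aH (2 * l) 0 := by
  have key : 1 / Real.pi ≤ aH (2*l) 0 ^ 2 * (4 * l + 1) := by
    induction l with
    | zero =>
      rw [mul_zero, aH_zero_zero, div_pow, Real.sq_sqrt Real.pi_pos.le]; simp
    | succ l ih =>
      refine ih.trans ?_
      have h := aH_rec_zero (2*l)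
      push_cast at h
      have hn : (0:ℝ) < 2 * l + 2 := by positivity
      have e : aH (2*l+2) 0 = (2*l+1) * aH (2*l) 0 / (2*l + 2) := by field_simp; linarith
      rw [show 2 * (l + 1) = 2 * l + 2 from by ring, e]
      push_cast
      rw [div_pow, div_mul_eq_mul_div, le_div_iff₀ (by positivity), mul_pow]
      have : (4 * (l:ℝ) + 1) * (2 * l + 2) ^ 2 ≤ (2 * l + 1) ^ 2 * (4 * (l + 1) + 1) := by nlinarith
      calc aH (2*l) 0 ^ 2 * (4 * (l:ℝ) + 1) * (2 * l + 2) ^ 2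
          = aH (2*l) 0 ^ 2 * ((4 * (l:ℝ) + 1) * (2 * l + 2) ^ 2) := by ring
        _ ≤ aH (2*l) 0 ^ 2 * ((2 * l + 1) ^ 2 * (4 * (l + 1) + 1)) := by gcongr
        _ = _ := by ring
  rw [div_le_iff₀ (by positivity)]
  have : 1 ≤ aH (2 * l) 0 ^ 2 * (4 * (4 * l + 1)) := by
    rw [div_le_iff₀ Real.pi_pos] at key
    have : aH (2*l) 0 ^ 2 * (4 * (l:ℝ) + 1) * Real.pi ≤ aH (2*l) 0 ^ 2 * (4 * (l:ℝ) + 1) * 4 := by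
      gcongr; exact Real.pi_le_four
    linarith
  apply le_of_sq_le_sq _ (mul_nonneg (aH_nonneg _ _) (Real.sqrt_nonneg _))
  rw [mul_pow, Real.sq_sqrt (by positivity)]; linarith

lemma aH_sum (n : ℕ) : ∑ i ∈ Finset.range (n+1), aH i 0 ≤ 2 * √((n:ℝ) + 1) := by
  have key : ∀ n : ℕ, ∑ i ∈ Finset.range n, aH i 0 ≤ 2 * √(n:ℝ) := by
    intro n
    induction n with
    | zero => simp
    | succ n ih =>
      rw [Finset.sum_range_succ]
      have h := aH_upper n
      push_cast
      have h1 : (0:ℝ) < √((n:ℝ)+1) := by positivity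
      have h2 := Real.sq_sqrt (by positivity : (0:ℝ) ≤ (n:ℝ)+1)
      have h3 := Real.sq_sqrt (by positivity : (0:ℝ) ≤ (n:ℝ))
      have h4 : 2 * √(n:ℝ) + 1 / √((n:ℝ)+1) ≤ 2 * √((n:ℝ)+1) := by
        have : 1 / √((n:ℝ)+1) ≤ 2 * √((n:ℝ)+1) - 2 * √(n:ℝ) := by
          rw [div_le_iff₀ h1]
          nlinarith [sq_nonneg (√((n:ℝ)+1) - √(n:ℝ))]
        linarith
      linarith
  have := key (n+1)
  push_cast at this
  exact this

lemma Erad_upper_aux (k : ℕ) {t M : ℝ} (ht : 0 ≤ t) (hM : 0 ≤ M) (N : ℕ) (h : ∀ n ≤ N, Erad 0 n t ≤ M) :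
    ∀ n ≤ N, Erad k n t ≤ (2 * √((n:ℝ) + 1)) ^ k * M := by
  induction k with
  | zero => simpa using h
  | succ k ih =>
    intro n hn
    simp only [Erad, convo]
    rw [Finset.Nat.sum_antidiagonal_eq_sum_range_succ_mk]
    calc ∑ i ∈ Finset.range n.succ, aH i 0 * Erad k (n - i) t
        ≤ ∑ i ∈ Finset.range n.succ, aH i 0 * ((2 * √((n:ℝ) + 1)) ^ k * M) := by
          apply Finset.sum_le_sum
          intro i _
          apply mul_le_mul_of_nonneg_left _ (aH_nonneg _ _)
          refine (ih (n - i) (by omega)).trans ?_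
          gcongr
          omega
      _ = (∑ i ∈ Finset.range n.succ, aH i 0) * ((2 * √((n:ℝ) + 1)) ^ k * M) := by rw [Finset.sum_mul]
      _ ≤ (2 * √((n:ℝ) + 1)) * ((2 * √((n:ℝ) + 1)) ^ k * M) := by
          gcongr; exact aH_sum n
      _ = _ := by ring

lemma Erad_upper (k : ℕ) : ∃ C : ℝ, 0 < C ∧ ∀ n t, 0 ≤ t → Erad k n t ≤ C * √((n:ℝ) + 1) ^ k := by
  obtain ⟨C, hC, h⟩ := f2_upper
  refine ⟨2 ^ k * (C / Real.pi), by positivity, fun n t ht => ?_⟩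
  refine (Erad_upper_aux k ht (M := C / Real.pi) (by positivity) n (fun m _ => ?_) n le_rfl).trans ?_
  · simp only [Erad]; gcongr; exact h m t ht
  · rw [mul_pow]; apply le_of_eq; ring

lemma Erad_tail (k : ℕ) (n : ℕ) {t : ℝ} (ht : 8 * (n:ℝ) ≤ t) :
    Erad k n t ≤ 2 ^ k * √((n:ℝ) + 1) ^ k * Real.exp (-t / 4) := by
  have ht0 : 0 ≤ t := le_trans (by positivity) ht
  refine (Erad_upper_aux k ht0 (M := Real.exp (-t/4)) (by positivity) n (fun m hm => ?_) n le_rfl).trans ?_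
  · simp only [Erad]
    rw [div_le_iff₀ Real.pi_pos]
    have h1 := f2_tail m ht0
    have h2 : (7:ℝ) ^ m ≤ Real.exp (t / 4) := by
      have e7 : (7:ℝ) ≤ Real.exp 2 := by
        have := Real.exp_one_gt_d9
        rw [show (2:ℝ) = 1 + 1 by norm_num, Real.exp_add]; nlinarith
      calc (7:ℝ) ^ m ≤ Real.exp 2 ^ m := by gcongr
        _ = Real.exp (m * 2) := by rw [← Real.exp_nat_mul]
        _ ≤ Real.exp (t / 4) := by
          apply Real.exp_le_exp.2
          have : (m:ℝ) ≤ n := by exact_mod_cast hm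
          linarith
    have h3 : (7:ℝ) ^ m * Real.exp (-t/2) ≤ Real.exp (t/4) * Real.exp (-t/2) := by gcongr
    rw [← Real.exp_add, show t / 4 + -t / 2 = -t / 4 by ring] at h3
    have := Real.pi_gt_three
    have := Real.exp_pos (-t/4)
    nlinarith
  · rw [mul_pow]

lemma Erad_lower (k : ℕ) : ∃ c a : ℝ, ∃ N : ℕ, 0 < c ∧ 0 < a ∧ 1 ≤ N ∧ ∀ n t, N ≤ n → 1 ≤ t → t ≤ a * n →
    c * √(n:ℝ) ^ k ≤ Erad k n t := by
  induction k with
  | zero =>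
    refine ⟨1 / 4 / Real.pi, 1 / 128, 165888, by positivity, by norm_num, by norm_num, fun n t hn ht hta => ?_⟩
    simp only [Erad, pow_zero, mul_one]
    gcongr
    exact f2_lower n hn ht (by linarith)
  | succ k ih =>
    obtain ⟨c, a, N, hc, ha, hN, h⟩ := ih
    refine ⟨c / (12 * 2 ^ k), a / 2, 2 * N, by positivity, by positivity, by omega, fun n t hn ht hta => ?_⟩
    have hn1 : 1 ≤ n := by omega
    have hn1' : (1:ℝ) ≤ n := by exact_mod_cast hn1
    have ht0 : 0 ≤ t := by linarith
    have hsq : 0 < √(n:ℝ) := by positivity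
    simp only [Erad, convo]
    rw [Finset.Nat.sum_antidiagonal_eq_sum_range_succ_mk]
    have hsub : (Finset.range (n/4+1)).image (fun l => 2 * l) ⊆ Finset.range n.succ := by
      intro x hx
      simp only [Finset.mem_image, Finset.mem_range] at hx ⊢
      omega
    have hterm : ∀ l ∈ Finset.range (n/4+1), 1 / (3 * √(n:ℝ)) * (c * (√(n:ℝ) / 2) ^ k)
        ≤ aH (2 * l) 0 * Erad k (n - 2 * l) t := by
      intro l hl
      have hl' : 4 * l ≤ n := by have := Finset.mem_range.1 hl; omega
      have hl2 : 4 * (l:ℝ) ≤ n := by exact_mod_cast hl'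
      have hm : (n:ℝ) / 2 ≤ ((n - 2 * l : ℕ) : ℝ) := by
        rw [Nat.cast_sub (by omega)]; push_cast; linarith
      apply mul_le_mul _ _ (by positivity) (aH_nonneg _ _)
      · refine le_trans ?_ (aH_lower l)
        apply one_div_le_one_div_of_le (by positivity)
        rw [Real.sqrt_le_left (by positivity), mul_pow, Real.sq_sqrt (by positivity)]
        linarith
      · refine le_trans ?_ (h (n - 2 * l) t (by omega) ht ?_)
        · gcongr
          rw [div_le_iff₀ (by norm_num)]
          apply Real.sqrt_le_iff.2
          refine ⟨by positivity, ?_⟩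
          rw [mul_pow, Real.sq_sqrt (by positivity)]; linarith
        · nlinarith
    calc c / (12 * 2 ^ k) * √(n:ℝ) ^ (k+1)
        = (n / 4) * (1 / (3 * √(n:ℝ)) * (c * (√(n:ℝ) / 2) ^ k)) := by
          rw [div_pow, pow_succ]
          have e := Real.sq_sqrt (by positivity : (0:ℝ) ≤ n)
          nth_rewrite 3 [← e]
          field_simp
          norm_num
      _ ≤ ((n / 4 + 1 : ℕ) : ℝ) * (1 / (3 * √(n:ℝ)) * (c * (√(n:ℝ) / 2) ^ k)) := by
          gcongr
          have : n ≤ 4 * (n / 4 + 1) := by omega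
          have : (n:ℝ) ≤ 4 * ((n / 4 + 1 : ℕ) : ℝ) := by exact_mod_cast this
          linarith
      _ = ∑ l ∈ Finset.range (n/4+1), (1 / (3 * √(n:ℝ)) * (c * (√(n:ℝ) / 2) ^ k)) := by
          rw [Finset.sum_const, Finset.card_range, nsmul_eq_mul]
      _ ≤ ∑ l ∈ Finset.range (n/4+1), aH (2 * l) 0 * Erad k (n - 2 * l) t := Finset.sum_le_sum hterm
      _ = ∑ i ∈ (Finset.range (n/4+1)).image (fun l => 2 * l), aH i 0 * Erad k (n - i) t := by
          rw [Finset.sum_image]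
          intro x _ y _ hxy
          simpa using hxy
      _ ≤ _ := by
          apply Finset.sum_le_sum_of_subset_of_nonneg hsub
          intro i _ _
          exact mul_nonneg (aH_nonneg _ _) (Erad_nonneg _ _ ht0)

open MeasureTheory
open scoped ENNReal NNReal

/-! Part 8: volumes of shells -/

def rho {d : ℕ} (x : Fin d → ℝ) : ℝ := ∑ i, x i ^ 2

lemma rho_nonneg {d : ℕ} (x : Fin d → ℝ) : 0 ≤ rho x := by unfold rho; positivity

lemma rho_continuous {d : ℕ} : Continuous (rho : (Fin d → ℝ) → ℝ) := by
  unfold rho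
  exact continuous_finsetSum _ fun i _ => (continuous_apply i).pow 2

lemma vol_unit (d : ℕ) : volume {x : Fin d → ℝ | rho x < 1} ≠ 0 ∧ volume {x : Fin d → ℝ | rho x < 1} ≠ ⊤ := by
  constructor
  · have ho : IsOpen {x : Fin d → ℝ | rho x < 1} := isOpen_lt rho_continuous continuous_const
    exact (ho.measure_pos volume ⟨0, by simp [rho]⟩).ne'
  · have hsub : {x : Fin d → ℝ | rho x < 1} ⊆ Set.Icc (fun _ => -1) (fun _ => 1) := by
      intro x hx
      have hx' : rho x < 1 := hx
      have : ∀ i, |x i| ≤ 1 := by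
        intro i
        have h1 : x i ^ 2 ≤ rho x :=
          Finset.single_le_sum (f := fun i => x i ^ 2) (fun j _ => sq_nonneg (x j)) (Finset.mem_univ i)
        exact abs_le_of_sq_le_sq (by linarith) (by norm_num)
      exact ⟨fun i => (abs_le.1 (this i)).1, fun i => (abs_le.1 (this i)).2⟩
    exact ((measure_mono hsub).trans_lt (isCompact_Icc.measure_lt_top)).ne

open scoped Pointwise in
lemma vol_ball {d : ℕ} (hd : d ≠ 0) {s : ℝ} (hs : 0 ≤ s) :
    volume {x : Fin d → ℝ | rho x < s} = ENNReal.ofReal (s ^ ((d:ℝ)/2)) * volume {x : Fin d → ℝ | rho x < 1} := by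
  rcases hs.eq_or_lt with h | h
  · subst h
    have : {x : Fin d → ℝ | rho x < 0} = ∅ := by
      ext x; simp [rho_nonneg x]
    rw [this, Real.zero_rpow (by positivity)]; simp
  · have hq : 0 < √s := Real.sqrt_pos.2 h
    have e : {x : Fin d → ℝ | rho x < s} = √s • {x : Fin d → ℝ | rho x < 1} := by
      ext x
      rw [Set.mem_smul_set_iff_inv_smul_mem₀ hq.ne']
      simp only [Set.mem_setOf_eq]
      have : rho ((√s)⁻¹ • x) = rho x / s := by
        unfold rho
        rw [Finset.sum_div]
        apply Finset.sum_congr rfl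
        intro i _
        simp only [Pi.smul_apply, smul_eq_mul, mul_pow, inv_pow, Real.sq_sqrt hs]
        field_simp
      rw [this, div_lt_one h]
    rw [e, Measure.addHaar_smul]
    congr 2
    rw [Module.finrank_fin_fun, abs_of_pos (by positivity), Real.sqrt_eq_rpow, ← Real.rpow_natCast,
      ← Real.rpow_mul hs]
    congr 1; ring

def shell {d : ℕ} (α : ℝ) (m : ℕ) : Set (Fin d → ℝ) := {x | α * m ≤ rho x ∧ rho x < α * (m + 1)}

lemma shell_meas {d : ℕ} (α : ℝ) (m : ℕ) : MeasurableSet (shell α m : Set (Fin d → ℝ)) := by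
  unfold shell
  exact (measurableSet_le measurable_const rho_continuous.measurable).inter
    (measurableSet_lt rho_continuous.measurable measurable_const)

lemma shell_disj {d : ℕ} {α : ℝ} (hα : 0 < α) :
    Pairwise (Function.onFun Disjoint (fun m : ℕ => (shell α m : Set (Fin d → ℝ)))) := by
  have key : ∀ m n : ℕ, ∀ x : Fin d → ℝ, x ∈ (shell α m : Set (Fin d → ℝ)) → x ∈ (shell α n : Set (Fin d → ℝ)) → m ≤ n := by
    intro m n x hm hn
    have h1 : α * m < α * (n + 1) := hm.1.trans_lt hn.2
    have h2 : (m:ℝ) < n + 1 := lt_of_mul_lt_mul_left h1 hα.le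
    have : m < n + 1 := by exact_mod_cast h2
    omega
  intro m n hmn
  apply Set.disjoint_left.2
  intro x hm hn
  exact hmn (le_antisymm (key m n x hm hn) (key n m x hn hm))

lemma shell_cover {d : ℕ} {α : ℝ} (hα : 0 < α) : (⋃ m : ℕ, (shell α m : Set (Fin d → ℝ))) = Set.univ := by
  ext x
  simp only [Set.mem_iUnion, Set.mem_univ, iff_true]
  refine ⟨⌊rho x / α⌋₊, ?_, ?_⟩
  · have := Nat.floor_le (div_nonneg (rho_nonneg x) hα.le)
    rw [le_div_iff₀ hα] at this
    linarith
  · have := Nat.lt_floor_add_one (rho x / α)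
    rw [div_lt_iff₀ hα] at this
    linarith

lemma shell_vol {d : ℕ} (hd : d ≠ 0) {α : ℝ} (hα : 0 < α) (m : ℕ) :
    volume (shell α m : Set (Fin d → ℝ)) =
      ENNReal.ofReal (α ^ ((d:ℝ)/2) * (((m:ℝ) + 1) ^ ((d:ℝ)/2) - (m:ℝ) ^ ((d:ℝ)/2)))
        * volume {x : Fin d → ℝ | rho x < 1} := by
  have e : (shell α m : Set (Fin d → ℝ)) = {x | rho x < α * (m + 1)} \ {x | rho x < α * m} := by
    ext x; simp [shell, and_comm]
  have hm : (0:ℝ) ≤ m := by positivity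
  rw [e, measure_sdiff]
  · rw [vol_ball hd (by positivity : 0 ≤ α * ((m:ℝ) + 1)), vol_ball hd (by positivity : 0 ≤ α * (m:ℝ)),
      ← ENNReal.sub_mul (fun _ _ => (vol_unit d).2), ← ENNReal.ofReal_sub _ (by positivity),
      Real.mul_rpow hα.le (by positivity), Real.mul_rpow hα.le (by positivity), mul_sub]
  · intro x hx
    have hx' : rho x < α * m := hx
    show rho x < α * (m + 1)
    nlinarith
  · exact (measurableSet_lt rho_continuous.measurable measurable_const).nullMeasurableSet
  · rw [vol_ball hd (by positivity)]
    exact ENNReal.mul_ne_top ENNReal.ofReal_ne_top (vol_unit d).2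

lemma rpow_diff_upper {r : ℝ} (hr : 1 ≤ r) (m : ℕ) :
    ((m:ℝ) + 1) ^ r - (m:ℝ) ^ r ≤ r * ((m:ℝ) + 1) ^ (r - 1) := by
  have hp : (0:ℝ) < m + 1 := by positivity
  have h := one_add_mul_self_le_rpow_one_add (s := -1 / ((m:ℝ) + 1)) (by
    rw [le_div_iff₀ hp]; have : (0:ℝ) ≤ m := by positivity
    linarith) hr
  have e : 1 + -1 / ((m:ℝ) + 1) = m / (m + 1) := by field_simp; ring
  rw [e, Real.div_rpow (by positivity) hp.le, le_div_iff₀ (by positivity)] at h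
  rw [Real.rpow_sub hp, Real.rpow_one]
  have : (1 + r * (-1 / ((m:ℝ) + 1))) * ((m:ℝ) + 1) ^ r = ((m:ℝ) + 1) ^ r - r * (((m:ℝ) + 1) ^ r / (m + 1)) := by
    field_simp; ring
  linarith

lemma rpow_diff_lower {r : ℝ} (hr : 1 ≤ r) {m : ℕ} (hm : 1 ≤ m) :
    (1 / 2) ^ (r - 1) * ((m:ℝ) + 1) ^ (r - 1) ≤ ((m:ℝ) + 1) ^ r - (m:ℝ) ^ r := by
  have hm' : (1:ℝ) ≤ m := by exact_mod_cast hm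
  have hp : (0:ℝ) < m := by linarith
  have h := one_add_mul_self_le_rpow_one_add (s := 1 / (m:ℝ)) (by
    have : 0 < 1 / (m:ℝ) := by positivity
    linarith) hr
  have e : 1 + 1 / (m:ℝ) = (m + 1) / m := by field_simp
  rw [e, Real.div_rpow (by positivity) hp.le, le_div_iff₀ (by positivity)] at h
  have h1 : (1 + r * (1 / (m:ℝ))) * (m:ℝ) ^ r = (m:ℝ) ^ r + r * (m:ℝ) ^ (r - 1) := by
    rw [Real.rpow_sub hp, Real.rpow_one]; field_simp
  rw [← Real.mul_rpow (by norm_num) (by positivity)]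
  have h2 : (1 / 2 * ((m:ℝ) + 1)) ^ (r - 1) ≤ (m:ℝ) ^ (r - 1) :=
    Real.rpow_le_rpow (by positivity) (by linarith) (by linarith)
  have h3 : 0 ≤ (m:ℝ) ^ (r - 1) := by positivity
  nlinarith

lemma shell_bounds {d : ℕ} (hd : 2 ≤ d) {α : ℝ} (hα : 0 < α) : ∃ V v : ℝ≥0∞, V ≠ ⊤ ∧ v ≠ 0 ∧ v ≠ ⊤ ∧
    (∀ m : ℕ, volume (shell α m : Set (Fin d → ℝ)) ≤ V * ((m + 1 : ℕ) : ℝ≥0∞) ^ ((d:ℝ)/2 - 1)) ∧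
    (∀ m : ℕ, 1 ≤ m → v * ((m + 1 : ℕ) : ℝ≥0∞) ^ ((d:ℝ)/2 - 1) ≤ volume (shell α m : Set (Fin d → ℝ))) := by
  have hr : (1:ℝ) ≤ (d:ℝ)/2 := by
    have : (2:ℝ) ≤ d := by exact_mod_cast hd
    linarith
  have hd0 : d ≠ 0 := by omega
  obtain ⟨w0, w1⟩ := vol_unit d
  set ω := volume {x : Fin d → ℝ | rho x < 1}
  set r := (d:ℝ)/2
  have ec : ∀ m : ℕ, ((m + 1 : ℕ) : ℝ≥0∞) ^ (r - 1) = ENNReal.ofReal (((m:ℝ) + 1) ^ (r - 1)) := by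
    intro m
    rw [← ENNReal.ofReal_rpow_of_pos (by positivity), ← ENNReal.ofReal_natCast]
    push_cast; rfl
  refine ⟨ENNReal.ofReal (α ^ r * r) * ω, ENNReal.ofReal (α ^ r * (1/2) ^ (r-1)) * ω,
    ENNReal.mul_ne_top ENNReal.ofReal_ne_top w1, mul_ne_zero ?_ w0,
    ENNReal.mul_ne_top ENNReal.ofReal_ne_top w1, fun m => ?_, fun m hm => ?_⟩
  · exact (ENNReal.ofReal_pos.2 (by positivity)).ne'
  · rw [shell_vol hd0 hα, ec, mul_right_comm, ← ENNReal.ofReal_mul (by positivity)]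
    refine mul_le_mul_left ?_ _
    apply ENNReal.ofReal_le_ofReal
    rw [mul_assoc]
    apply mul_le_mul_of_nonneg_left _ (by positivity)
    exact rpow_diff_upper hr m
  · rw [shell_vol hd0 hα, ec, mul_right_comm, ← ENNReal.ofReal_mul (by positivity)]
    refine mul_le_mul_left ?_ _
    apply ENNReal.ofReal_le_ofReal
    rw [mul_assoc]
    apply mul_le_mul_of_nonneg_left _ (by positivity)
    exact rpow_diff_lower hr hm

open MeasureTheory
open scoped ENNReal NNReal

/-! Part 9: abstract integration argument -/

lemma add_rpow_le' (a b : ℝ≥0∞) {q : ℝ} (hq : 0 ≤ q) : (a + b) ^ q ≤ 2 ^ q * (a ^ q + b ^ q) := by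
  have h1 : a + b ≤ 2 * max a b := by
    rw [two_mul]; exact add_le_add (le_max_left _ _) (le_max_right _ _)
  calc (a + b) ^ q ≤ (2 * max a b) ^ q := ENNReal.rpow_le_rpow h1 hq
    _ = 2 ^ q * (max a b) ^ q := ENNReal.mul_rpow_of_nonneg _ _ hq
    _ ≤ _ := by
      gcongr
      rcases le_total a b with h | h
      · rw [max_eq_right h]; exact le_add_self
      · rw [max_eq_left h]; exact le_self_add

lemma le_inv_mul' {κ x y : ℝ≥0∞} (h0 : κ ≠ 0) (h1 : κ ≠ ⊤) (h : κ * x ≤ y) : x ≤ κ⁻¹ * y := by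
  calc x = κ⁻¹ * (κ * x) := by rw [← mul_assoc, ENNReal.inv_mul_cancel h0 h1, one_mul]
    _ ≤ _ := by gcongr

lemma tsum_split (f : ℕ → ℝ≥0∞) (k : ℕ) : ∑' n, f n = ∑ i ∈ Finset.range k, f i + ∑' i, f (i + k) :=
  (ENNReal.summable.sum_add_tsum_nat_add').symm

noncomputable def Sf (W s : ℕ → ℝ≥0∞) (m : ℕ) : ℝ≥0∞ := ∑' j, s (m + 1 + j) * W (m + 1 + j)

noncomputable def If {d : ℕ} (E : ℕ → (Fin d → ℝ) → ℝ≥0∞) (q : ℝ) (s : ℕ → ℝ≥0∞) : ℝ≥0∞ :=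
  ∫⁻ x : Fin d → ℝ, (∑' n, s n * E n x) ^ q

noncomputable def Qf (d : ℕ) (W : ℕ → ℝ≥0∞) (q : ℝ) (s : ℕ → ℝ≥0∞) : ℝ≥0∞ :=
  ∑' m : ℕ, ((m + 1 : ℕ) : ℝ≥0∞) ^ ((d:ℝ)/2 - 1) * (Sf W s m) ^ q

lemma If_shells {d : ℕ} (E : ℕ → (Fin d → ℝ) → ℝ≥0∞) (q : ℝ) (s : ℕ → ℝ≥0∞) {α : ℝ} (hα : 0 < α) :
    If E q s = ∑' m, ∫⁻ x in shell α m, (∑' n, s n * E n x) ^ q := by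
  rw [← lintegral_iUnion (shell_meas α) (shell_disj hα), shell_cover hα, setLIntegral_univ]; rfl

lemma theta_sum (d : ℕ) {q : ℝ} (hq : 0 < q) :
    ∑' m : ℕ, ((m + 1 : ℕ) : ℝ≥0∞) ^ ((d:ℝ)/2 - 1) * (ENNReal.ofReal (Real.exp (-(2 * m)))) ^ q ≠ ⊤ := by
  have h := (summable_nat_add_iff 1).2 (Real.summable_pow_mul_exp_neg_nat_mul d (r := 2 * q) (by positivity))
  have h2 := (h.mul_left (Real.exp (2 * q))).tsum_ofReal_ne_top
  refine ne_top_of_le_ne_top h2 (ENNReal.tsum_le_tsum fun m => ?_)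
  rw [ENNReal.ofReal_rpow_of_pos (Real.exp_pos _), ← Real.exp_mul]
  rw [mul_left_comm, ENNReal.ofReal_mul (by positivity)]
  apply mul_le_mul'
  · rw [ENNReal.ofReal_pow (by positivity), ENNReal.ofReal_natCast, ← ENNReal.rpow_natCast]
    apply ENNReal.rpow_le_rpow_of_exponent_le
    · exact_mod_cast Nat.le_add_left 1 m
    · have : (0:ℝ) ≤ d := by positivity
      linarith
  · apply ENNReal.ofReal_le_ofReal
    rw [← Real.exp_add]
    apply le_of_eq
    congr 1
    push_cast; ring

lemma abs_upper {d : ℕ} (hd : 2 ≤ d) {q : ℝ} (hq : 0 < q) (E : ℕ → (Fin d → ℝ) → ℝ≥0∞) (W : ℕ → ℝ≥0∞)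
    (K : ℝ≥0∞) (hK : K ≠ ⊤)
    (h0 : ∀ x, E 0 x ≤ K * ENNReal.ofReal (Real.exp (-(rho x) / 4)))
    (ha : ∀ (n : ℕ) x, 1 ≤ n → E n x ≤ K * W n)
    (hb : ∀ (n : ℕ) x, 1 ≤ n → 8 * (n:ℝ) ≤ rho x → E n x ≤ K * W n * ENNReal.ofReal (Real.exp (-(rho x) / 4))) :
    ∃ C : ℝ≥0∞, C ≠ ⊤ ∧ ∀ s : ℕ → ℝ≥0∞, If E q s ≤ C * ((s 0) ^ q + Qf d W q s) := by
  obtain ⟨V, -, hV, -, -, hVu, -⟩ := shell_bounds hd (α := 8) (by norm_num)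
  have hG := theta_sum d hq
  set G := ∑' m : ℕ, ((m + 1 : ℕ) : ℝ≥0∞) ^ ((d:ℝ)/2 - 1) * (ENNReal.ofReal (Real.exp (-(2 * m)))) ^ q with hGd
  set B : ℝ≥0∞ := V * (2 ^ q * K ^ q) with hB
  have h2q : (2:ℝ≥0∞) ^ q ≠ ⊤ := ENNReal.rpow_ne_top_of_nonneg hq.le (by norm_num)
  have hKq : K ^ q ≠ ⊤ := ENNReal.rpow_ne_top_of_nonneg hq.le hK
  have hBt : B ≠ ⊤ := ENNReal.mul_ne_top hV (ENNReal.mul_ne_top h2q hKq)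
  refine ⟨B * (2 ^ q * G + 1), ENNReal.mul_ne_top hBt (ENNReal.add_ne_top.2 ⟨ENNReal.mul_ne_top h2q hG, by simp⟩), fun s => ?_⟩
  have hpt : ∀ m : ℕ, ∀ x ∈ (shell 8 m : Set (Fin d → ℝ)), ∑' n, s n * E n x ≤
      K * ((s 0 + Sf W s 0) * ENNReal.ofReal (Real.exp (-(2 * m))) + Sf W s m) := by
    intro m x hx
    set θ := ENNReal.ofReal (Real.exp (-(2 * m)))
    have hθ : ENNReal.ofReal (Real.exp (-(rho x) / 4)) ≤ θ := by
      apply ENNReal.ofReal_le_ofReal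
      apply Real.exp_le_exp.2
      have := hx.1
      linarith
    rw [tsum_eq_zero_add' ENNReal.summable]
    have t0 : s 0 * E 0 x ≤ K * (s 0 * θ) := by
      calc s 0 * E 0 x ≤ s 0 * (K * θ) := by gcongr; exact (h0 x).trans (by gcongr)
        _ = _ := by ring
    have t1 : ∑' j, s (j + 1) * E (j + 1) x ≤ ∑' j, (K * θ * (s (j+1) * W (j+1)) +
        K * (if m ≤ j then s (j+1) * W (j+1) else 0)) := by
      apply ENNReal.tsum_le_tsum
      intro j
      by_cases hj : m ≤ j
      · rw [if_pos hj]
        calc s (j+1) * E (j+1) x ≤ s (j+1) * (K * W (j+1)) := by gcongr; exact ha _ _ (by omega)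
          _ = K * (s (j+1) * W (j+1)) := by ring
          _ ≤ _ := le_add_self
      · rw [if_neg hj, mul_zero, add_zero]
        calc s (j+1) * E (j+1) x ≤ s (j+1) * (K * W (j+1) * θ) := by
              gcongr
              refine (hb _ _ (by omega) ?_).trans (by gcongr)
              have h1 := hx.1
              have h2 : ((j + 1 : ℕ):ℝ) ≤ m := by
                exact_mod_cast (by omega : j + 1 ≤ m)
              linarith
          _ = _ := by ring
    have t2 : ∑' j, (K * θ * (s (j+1) * W (j+1)) + K * (if m ≤ j then s (j+1) * W (j+1) else 0))
        = K * (Sf W s 0 * θ + Sf W s m) := by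
      rw [ENNReal.tsum_add, ENNReal.tsum_mul_left, ENNReal.tsum_mul_left]
      have e1 : ∑' j, s (j+1) * W (j+1) = Sf W s 0 := by
        unfold Sf; congr 1; funext j; rw [show 0 + 1 + j = j + 1 by omega]
      have e2 : ∑' j, (if m ≤ j then s (j+1) * W (j+1) else 0) = Sf W s m := by
        rw [tsum_split _ m]
        have : ∑ i ∈ Finset.range m, (if m ≤ i then s (i+1) * W (i+1) else 0) = 0 := by
          apply Finset.sum_eq_zero
          intro i hi
          rw [if_neg (by have := Finset.mem_range.1 hi; omega)]
        rw [this, zero_add]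
        unfold Sf; congr 1; funext j
        rw [if_pos (by omega), show m + 1 + j = j + m + 1 by omega]
      rw [e1, e2]; ring
    calc _ ≤ K * (s 0 * θ) + K * (Sf W s 0 * θ + Sf W s m) := add_le_add t0 (t1.trans t2.le)
      _ = _ := by ring
  rw [If_shells E q s (by norm_num : (0:ℝ) < 8)]
  have hsh : ∀ m : ℕ, ∫⁻ x in shell 8 m, (∑' n, s n * E n x) ^ q ≤
      B * (s 0 + Sf W s 0) ^ q * (((m + 1 : ℕ) : ℝ≥0∞) ^ ((d:ℝ)/2 - 1) * (ENNReal.ofReal (Real.exp (-(2 * m)))) ^ q)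
      + B * (((m + 1 : ℕ) : ℝ≥0∞) ^ ((d:ℝ)/2 - 1) * (Sf W s m) ^ q) := by
    intro m
    set θ := ENNReal.ofReal (Real.exp (-(2 * m)))
    calc ∫⁻ x in shell 8 m, (∑' n, s n * E n x) ^ q
        ≤ ∫⁻ x in shell 8 m, (K * ((s 0 + Sf W s 0) * θ + Sf W s m)) ^ q := by
          apply setLIntegral_mono' (shell_meas 8 m)
          intro x hx
          exact ENNReal.rpow_le_rpow (hpt m x hx) hq.le
      _ = (K * ((s 0 + Sf W s 0) * θ + Sf W s m)) ^ q * volume (shell 8 m : Set (Fin d → ℝ)) := setLIntegral_const _ _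
      _ ≤ (K ^ q * (2 ^ q * ((s 0 + Sf W s 0) ^ q * θ ^ q + (Sf W s m) ^ q))) * (V * ((m + 1 : ℕ) : ℝ≥0∞) ^ ((d:ℝ)/2 - 1)) := by
          apply mul_le_mul' _ (hVu m)
          rw [ENNReal.mul_rpow_of_nonneg _ _ hq.le]
          gcongr
          refine (add_rpow_le' _ _ hq.le).trans ?_
          rw [ENNReal.mul_rpow_of_nonneg _ _ hq.le]
      _ = _ := by rw [hB]; ring
  refine (ENNReal.tsum_le_tsum hsh).trans ?_
  rw [ENNReal.tsum_add, ENNReal.tsum_mul_left, ENNReal.tsum_mul_left, ← hGd]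
  have hS0 : (Sf W s 0) ^ q ≤ Qf d W q s := by
    have := ENNReal.le_tsum (f := fun m : ℕ => ((m + 1 : ℕ) : ℝ≥0∞) ^ ((d:ℝ)/2 - 1) * (Sf W s m) ^ q) 0
    unfold Qf
    simpa using this
  change B * (s 0 + Sf W s 0) ^ q * G + B * Qf d W q s ≤ _
  calc B * (s 0 + Sf W s 0) ^ q * G + B * Qf d W q s
      ≤ B * (2 ^ q * (s 0 ^ q + Qf d W q s)) * G + B * (s 0 ^ q + Qf d W q s) := by
        gcongr
        · exact (add_rpow_le' _ _ hq.le).trans (by gcongr)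
        · exact le_add_self
    _ = _ := by ring

lemma abs_lower {d : ℕ} (hd : 2 ≤ d) {q : ℝ} (hq : 0 < q) (E : ℕ → (Fin d → ℝ) → ℝ≥0∞) (W : ℕ → ℝ≥0∞)
    (hW : ∀ n, 1 ≤ n → W n ≤ 1) (hE : ∀ n, Measurable (E n))
    (hpos : ∀ n, ∫⁻ x, (E n x) ^ q ≠ 0)
    (c0 : ℝ≥0∞) (hc0 : c0 ≠ 0) (hc1 : c0 ≠ ⊤) (a : ℝ) (ha : 0 < a) (N : ℕ)
    (hc : ∀ (n : ℕ) x, N ≤ n → 1 ≤ rho x → rho x ≤ a * n → c0 * W n ≤ E n x) :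
    ∃ C : ℝ≥0∞, C ≠ ⊤ ∧ ∀ s : ℕ → ℝ≥0∞, (s 0) ^ q ≤ C * If E q s ∧ Qf d W q s ≤ C * If E q s := by
  obtain ⟨-, v, -, hv0, hv1, -, hvl⟩ := shell_bounds hd ha
  have hsn : ∀ n, ∃ C : ℝ≥0∞, C ≠ ⊤ ∧ ∀ s : ℕ → ℝ≥0∞, (s n) ^ q ≤ C * If E q s := by
    intro n
    set κ := min 1 (∫⁻ x, (E n x) ^ q) with hκ
    have k0 : κ ≠ 0 := by
      rw [hκ]; exact (lt_min one_pos (pos_iff_ne_zero.2 (hpos n))).ne'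
    have k1 : κ ≠ ⊤ := ne_top_of_le_ne_top ENNReal.one_ne_top (min_le_left _ _)
    refine ⟨κ⁻¹, ENNReal.inv_ne_top.2 k0, fun s => le_inv_mul' k0 k1 ?_⟩
    calc κ * s n ^ q ≤ (∫⁻ x, (E n x) ^ q) * s n ^ q := by gcongr; exact min_le_right _ _
      _ = ∫⁻ x, (E n x) ^ q * s n ^ q := (lintegral_mul_const _ ((hE n).pow_const q)).symm
      _ ≤ If E q s := by
        apply lintegral_mono
        intro x
        simp only
        rw [← ENNReal.mul_rpow_of_nonneg _ _ hq.le, mul_comm]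
        exact ENNReal.rpow_le_rpow (ENNReal.le_tsum (f := fun n => s n * E n x) n) hq.le
  set m1 : ℕ := max (max N ⌈1 / a⌉₊) 1 with hm1
  have hm1N : N ≤ m1 := (le_max_left _ _).trans (le_max_left _ _)
  have hm1a : 1 ≤ a * m1 := by
    have h1 : 1 / a ≤ m1 := (Nat.le_ceil _).trans (by exact_mod_cast (le_max_right _ _).trans (le_max_left _ _))
    rw [div_le_iff₀ ha] at h1; linarith
  have hm11 : 1 ≤ m1 := le_max_right _ _
  set κ := v * c0 ^ q with hκ
  have k0 : κ ≠ 0 := mul_ne_zero hv0 (by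
    rw [ne_eq, ENNReal.rpow_eq_zero_iff]; push Not; exact ⟨fun h => absurd h hc0, fun h => absurd h hc1⟩)
  have k1 : κ ≠ ⊤ := ENNReal.mul_ne_top hv1 (ENNReal.rpow_ne_top_of_nonneg hq.le hc1)
  have hshell : ∀ s : ℕ → ℝ≥0∞, ∀ m, m1 ≤ m → ((m + 1 : ℕ) : ℝ≥0∞) ^ ((d:ℝ)/2 - 1) * (Sf W s m) ^ q ≤
      κ⁻¹ * ∫⁻ x in shell a m, (∑' n, s n * E n x) ^ q := by
    intro s m hm
    apply le_inv_mul' k0 k1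
    have hm' : (m1:ℝ) ≤ m := by exact_mod_cast hm
    calc κ * (((m + 1 : ℕ) : ℝ≥0∞) ^ ((d:ℝ)/2 - 1) * (Sf W s m) ^ q)
        = (c0 * Sf W s m) ^ q * (v * ((m + 1 : ℕ) : ℝ≥0∞) ^ ((d:ℝ)/2 - 1)) := by
          rw [ENNReal.mul_rpow_of_nonneg _ _ hq.le, hκ]; ring
      _ ≤ (c0 * Sf W s m) ^ q * volume (shell a m : Set (Fin d → ℝ)) := by
          gcongr; exact hvl m (by omega)
      _ = ∫⁻ x in shell a m, (c0 * Sf W s m) ^ q := (setLIntegral_const _ _).symm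
      _ ≤ _ := by
          apply setLIntegral_mono' (shell_meas a m)
          intro x hx
          apply ENNReal.rpow_le_rpow _ hq.le
          unfold Sf
          rw [← ENNReal.tsum_mul_left]
          calc ∑' j, c0 * (s (m + 1 + j) * W (m + 1 + j)) ≤ ∑' j, s (m + 1 + j) * E (m + 1 + j) x := by
                apply ENNReal.tsum_le_tsum
                intro j
                rw [mul_left_comm]
                gcongr
                apply hc _ _ (by omega)
                · have := hx.1
                  have : a * m1 ≤ a * m := by gcongr
                  linarith
                · have := hx.2
                  have h2 : a * ((m:ℝ) + 1) ≤ a * ((m + 1 + j : ℕ) : ℝ) := by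
                    gcongr; push_cast; linarith [(by positivity : (0:ℝ) ≤ j)]
                  linarith
            _ ≤ _ := ENNReal.tsum_comp_le_tsum_of_injective (f := fun j => m + 1 + j)
                (fun i j h => by simpa using h) (fun n => s n * E n x)
  have hshI : ∀ s : ℕ → ℝ≥0∞, ∀ m, ∫⁻ x in shell a m, (∑' n, s n * E n x) ^ q ≤ If E q s :=
    fun s m => setLIntegral_le_lintegral _ _
  have hone : ∀ m : ℕ, (1:ℝ≥0∞) ≤ ((m + 1 : ℕ) : ℝ≥0∞) ^ ((d:ℝ)/2 - 1) := by
    intro m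
    rw [← ENNReal.one_rpow ((d:ℝ)/2 - 1)]
    apply ENNReal.rpow_le_rpow
    · exact_mod_cast Nat.le_add_left 1 m
    · have : (2:ℝ) ≤ d := by exact_mod_cast hd
      linarith
  have hSm : ∀ j m, m + j = m1 → ∃ C : ℝ≥0∞, C ≠ ⊤ ∧ ∀ s : ℕ → ℝ≥0∞, (Sf W s m) ^ q ≤ C * If E q s := by
    intro j
    induction j with
    | zero =>
      intro m hm
      refine ⟨κ⁻¹, ENNReal.inv_ne_top.2 k0, fun s => ?_⟩
      calc (Sf W s m) ^ q = 1 * (Sf W s m) ^ q := (one_mul _).symm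
        _ ≤ ((m + 1 : ℕ) : ℝ≥0∞) ^ ((d:ℝ)/2 - 1) * (Sf W s m) ^ q := by gcongr; exact hone m
        _ ≤ _ := (hshell s m (by omega)).trans (by gcongr; exact hshI s m)
    | succ j ih =>
      intro m hm
      obtain ⟨C1, hC1, h1⟩ := ih (m+1) (by omega)
      obtain ⟨C2, hC2, h2⟩ := hsn (m+1)
      have h2q : (2:ℝ≥0∞) ^ q ≠ ⊤ := ENNReal.rpow_ne_top_of_nonneg hq.le (by norm_num)
      refine ⟨2 ^ q * (C2 + C1), ENNReal.mul_ne_top h2q (ENNReal.add_ne_top.2 ⟨hC2, hC1⟩), fun s => ?_⟩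
      have e : Sf W s m ≤ s (m+1) + Sf W s (m+1) := by
        unfold Sf
        rw [tsum_eq_zero_add' ENNReal.summable]
        apply add_le_add
        · rw [add_zero]
          calc s (m+1) * W (m+1) ≤ s (m+1) * 1 := by gcongr; exact hW _ (by omega)
            _ = _ := mul_one _
        · apply le_of_eq; congr 1; funext i
          rw [show m + 1 + (i + 1) = m + 1 + 1 + i by omega]
      calc (Sf W s m) ^ q ≤ (s (m+1) + Sf W s (m+1)) ^ q := ENNReal.rpow_le_rpow e hq.le
        _ ≤ 2 ^ q * (s (m+1) ^ q + Sf W s (m+1) ^ q) := add_rpow_le' _ _ hq.le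
        _ ≤ 2 ^ q * (C2 * If E q s + C1 * If E q s) := by gcongr; exacts [h2 s, h1 s]
        _ = _ := by ring
  have hSm' : ∀ m, ∃ C : ℝ≥0∞, C ≠ ⊤ ∧ (m < m1 → ∀ s : ℕ → ℝ≥0∞, (Sf W s m) ^ q ≤ C * If E q s) := by
    intro m
    by_cases h : m < m1
    · obtain ⟨C, hC, h'⟩ := hSm (m1 - m) m (by omega)
      exact ⟨C, hC, fun _ => h'⟩
    · exact ⟨0, by simp, fun h' => absurd h' h⟩
  choose Cm hCm hCm' using hSm'
  obtain ⟨C0, hC0, h0⟩ := hsn 0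
  set CF := ∑ m ∈ Finset.range m1, ((m + 1 : ℕ) : ℝ≥0∞) ^ ((d:ℝ)/2 - 1) * Cm m with hCF
  have hCFt : CF ≠ ⊤ := by
    rw [hCF]
    refine (ENNReal.sum_lt_top.2 fun m _ => ?_).ne
    refine (ENNReal.mul_ne_top ?_ (hCm m)).lt_top
    exact ENNReal.rpow_ne_top_of_ne_zero (by simp) (by simp)
  refine ⟨C0 + (CF + κ⁻¹), ENNReal.add_ne_top.2 ⟨hC0, ENNReal.add_ne_top.2 ⟨hCFt, ENNReal.inv_ne_top.2 k0⟩⟩, fun s => ⟨?_, ?_⟩⟩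
  · exact (h0 s).trans (mul_le_mul' le_self_add le_rfl)
  · have hQ : Qf d W q s ≤ (CF + κ⁻¹) * If E q s := by
      unfold Qf
      rw [tsum_split _ m1, add_mul]
      apply add_le_add
      · rw [hCF, Finset.sum_mul]
        apply Finset.sum_le_sum
        intro m hm
        rw [mul_assoc]
        gcongr
        exact hCm' m (Finset.mem_range.1 hm) s
      · calc ∑' i, (((i + m1 + 1 : ℕ) : ℝ≥0∞) ^ ((d:ℝ)/2 - 1) * (Sf W s (i + m1)) ^ q)
            ≤ ∑' i, κ⁻¹ * ∫⁻ x in shell a (i + m1), (∑' n, s n * E n x) ^ q :=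
              ENNReal.tsum_le_tsum fun i => hshell s (i + m1) (by omega)
          _ = κ⁻¹ * ∑' i, ∫⁻ x in shell a (i + m1), (∑' n, s n * E n x) ^ q := ENNReal.tsum_mul_left
          _ ≤ κ⁻¹ * If E q s := by
              gcongr
              rw [If_shells E q s ha]
              exact ENNReal.tsum_comp_le_tsum_of_injective (f := fun i => i + m1)
                (fun i j h => by simpa using h) (fun m => ∫⁻ x in shell a m, (∑' n, s n * E n x) ^ q)
    exact hQ.trans (mul_le_mul' le_add_self le_rfl)

open MeasureTheory
open scoped ENNReal NNReal

/-! Part 10: assembly -/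

noncomputable def EE (d n : ℕ) (x : Fin d → ℝ) : ℝ≥0∞ := ENNReal.ofReal (eSpec d n x / (Ddim d n))
noncomputable def WW (d n : ℕ) : ℝ≥0∞ := (((n : ℕ) : ℝ≥0∞) ^ ((d:ℝ)/2))⁻¹

lemma Ddim_lower (k n : ℕ) : (n:ℝ)^(k+1) / (k+1).factorial ≤ (Ddim (k+2) n : ℝ) := by
  have h := Nat.pow_le_choose (α := ℝ) (k+1) (n+(k+1))
  have e : Ddim (k+2) n = (n+(k+1)).choose (k+1) := rfl
  rw [e]
  refine le_trans ?_ h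
  gcongr
  omega

lemma Ddim_upper (k n : ℕ) (hn : 1 ≤ n) : (Ddim (k+2) n : ℝ) ≤ ((k:ℝ)+2)^(k+1) * (n:ℝ)^(k+1) := by
  have h := Nat.choose_le_pow (n+(k+1)) (k+1)
  have e : Ddim (k+2) n = (n+(k+1)).choose (k+1) := rfl
  rw [e, ← mul_pow]
  have h2 : (((n+(k+1)).choose (k+1) : ℕ) : ℝ) ≤ ((n+(k+1) : ℕ) : ℝ)^(k+1) := by exact_mod_cast h
  refine h2.trans ?_
  gcongr
  have : (1:ℝ) ≤ n := by exact_mod_cast hn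
  have hk : (0:ℝ) ≤ k := by positivity
  push_cast
  nlinarith

lemma Ddim_pos (k n : ℕ) : (0:ℝ) < (Ddim (k+2) n : ℝ) := by
  have e : Ddim (k+2) n = (n+(k+1)).choose (k+1) := rfl
  rw [e]
  exact_mod_cast Nat.choose_pos (by omega)

lemma WW_eq (k n : ℕ) (hn : 1 ≤ n) : WW (k+2) n = ENNReal.ofReal (√(n:ℝ)^k / (n:ℝ)^(k+1)) := by
  have hn0 : (0:ℝ) < n := by exact_mod_cast hn
  unfold WW
  rw [← ENNReal.ofReal_natCast n, ENNReal.ofReal_rpow_of_pos hn0, ← ENNReal.ofReal_inv_of_pos (by positivity)]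
  congr 1
  rw [Real.sqrt_eq_rpow, ← Real.rpow_natCast, ← Real.rpow_natCast, ← Real.rpow_mul hn0.le, ← Real.rpow_sub hn0,
    ← Real.rpow_neg hn0.le]
  congr 1
  push_cast; ring

lemma WW_le_one (k n : ℕ) (hn : 1 ≤ n) : WW (k+2) n ≤ 1 := by
  unfold WW
  rw [ENNReal.inv_le_one, ← ENNReal.one_rpow (((k+2:ℕ):ℝ)/2)]
  exact ENNReal.rpow_le_rpow (by exact_mod_cast hn) (by positivity)

lemma sqrt_succ_le (k n : ℕ) (hn : 1 ≤ n) : √((n:ℝ)+1)^k ≤ 2^k * √(n:ℝ)^k := by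
  rw [← mul_pow]
  have hn0 : (1:ℝ) ≤ n := by exact_mod_cast hn
  gcongr
  rw [Real.sqrt_le_left (by positivity), mul_pow, Real.sq_sqrt (by positivity)]
  linarith

lemma EE_up (k n : ℕ) (hn : 1 ≤ n) (x : Fin (k+2) → ℝ) (A : ℝ) (hA : 0 ≤ A)
    (h : eSpec (k+2) n x ≤ A * √((n:ℝ)+1)^k) :
    EE (k+2) n x ≤ ENNReal.ofReal (A * 2^k * (k+1).factorial) * WW (k+2) n := by
  have hn0 : (0:ℝ) < n := by exact_mod_cast hn
  rw [WW_eq k n hn, ← ENNReal.ofReal_mul (by positivity)]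
  apply ENNReal.ofReal_le_ofReal
  calc eSpec (k+2) n x / (Ddim (k+2) n) ≤ (A * (2^k * √(n:ℝ)^k)) / ((n:ℝ)^(k+1) / (k+1).factorial) := by
        apply div_le_div₀ (by positivity) _ (by positivity) (Ddim_lower k n)
        refine h.trans ?_
        exact mul_le_mul_of_nonneg_left (sqrt_succ_le k n hn) hA
    _ = _ := by field_simp

lemma upper_final (k : ℕ) {q : ℝ} (hq : 0 < q) :
    ∃ C : ℝ≥0∞, C ≠ ⊤ ∧ ∀ s : ℕ → ℝ≥0∞, If (EE (k+2)) q s ≤ C * ((s 0) ^ q + Qf (k+2) (WW (k+2)) q s) := by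
  obtain ⟨A, hA, hEA⟩ := Erad_upper k
  set M : ℝ := max 1 (max A (2^k)) with hM
  have hM1 : 1 ≤ M := le_max_left _ _
  have hMA : A ≤ M := (le_max_left _ _).trans (le_max_right _ _)
  have hM2 : 2^k ≤ M := (le_max_right _ _).trans (le_max_right _ _)
  have hf : (1:ℝ) ≤ (k+1).factorial := by exact_mod_cast Nat.factorial_pos (k+1)
  have h2k : (1:ℝ) ≤ 2^k := one_le_pow₀ (by norm_num)
  refine abs_upper (by omega) hq (EE (k+2)) (WW (k+2)) (ENNReal.ofReal (M * 2^k * (k+1).factorial))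
    ENNReal.ofReal_ne_top ?_ ?_ ?_
  · intro x
    rw [← ENNReal.ofReal_mul (by positivity)]
    apply ENNReal.ofReal_le_ofReal
    have hD : (Ddim (k+2) 0 : ℝ) = 1 := by
      have e : Ddim (k+2) 0 = (0+(k+1)).choose (k+1) := rfl
      rw [e]; simp
    rw [hD, div_one, eSpec_eq_Erad]
    refine (Erad_tail k 0 (by have h9 := rho_nonneg x; unfold rho at h9; simpa using h9)).trans ?_
    have : M ≤ M * 2^k * (k+1).factorial := by
      have h1 : M ≤ M * 2^k := le_mul_of_one_le_right (by linarith) h2k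
      exact h1.trans (le_mul_of_one_le_right (by positivity) hf)
    have h3 : √(((0:ℕ):ℝ)+1)^k = 1 := by simp
    rw [h3, mul_one]
    exact mul_le_mul_of_nonneg_right (hM2.trans this) (Real.exp_pos _).le
  · intro n x hn
    apply EE_up k n hn x M (by linarith)
    rw [eSpec_eq_Erad]
    refine (hEA n _ (rho_nonneg x)).trans ?_
    gcongr
  · intro n x hn hx
    have h := EE_up k n hn x (M * Real.exp (-(rho x)/4)) (by positivity) (by
      rw [eSpec_eq_Erad]
      refine (Erad_tail k n hx).trans ?_
      rw [mul_right_comm]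
      change 2^k * Real.exp (-(rho x)/4) * _ ≤ _
      gcongr)
    refine h.trans (le_of_eq ?_)
    rw [mul_right_comm (ENNReal.ofReal _), ← ENNReal.ofReal_mul (by positivity)]
    congr 2
    ring

lemma EE_meas (d n : ℕ) : Measurable (EE d n) :=
  ENNReal.measurable_ofReal.comp ((eSpec_continuous d n).measurable.div_const _)

lemma EE_pos (k n : ℕ) {q : ℝ} (hq : 0 < q) : ∫⁻ x, (EE (k+2) n x) ^ q ≠ 0 := by
  obtain ⟨x0, hx0⟩ := eSpec_pos (k+1) n
  rw [ne_eq, lintegral_eq_zero_iff ((EE_meas (k+2) n).pow_const q)]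
  intro h
  have hU : IsOpen {x : Fin (k+2) → ℝ | 0 < eSpec (k+2) n x} := isOpen_lt continuous_const (eSpec_continuous _ n)
  have hpos := hU.measure_pos volume ⟨x0, hx0⟩
  rw [Filter.EventuallyEq, ae_iff] at h
  refine hpos.ne' (measure_mono_null ?_ h)
  intro x hx
  simp only [Set.mem_ofPred_eq, Pi.zero_apply] at hx ⊢
  have : 0 < EE (k+2) n x := ENNReal.ofReal_pos.2 (div_pos hx (Ddim_pos k n))
  rw [ENNReal.rpow_eq_zero_iff]
  push Not
  exact ⟨fun h => absurd h this.ne', fun _ => hq.le⟩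

lemma lower_final (k : ℕ) {q : ℝ} (hq : 0 < q) :
    ∃ C : ℝ≥0∞, C ≠ ⊤ ∧ ∀ s : ℕ → ℝ≥0∞, (s 0) ^ q ≤ C * If (EE (k+2)) q s ∧
      Qf (k+2) (WW (k+2)) q s ≤ C * If (EE (k+2)) q s := by
  obtain ⟨c, a, N, hc, ha, hN, h⟩ := Erad_lower k
  have hk2 : (0:ℝ) < ((k:ℝ)+2)^(k+1) := by positivity
  refine abs_lower (by omega) hq (EE (k+2)) (WW (k+2)) (WW_le_one k) (EE_meas (k+2)) (fun n => EE_pos k n hq)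
    (ENNReal.ofReal (c / ((k:ℝ)+2)^(k+1))) (ENNReal.ofReal_pos.2 (div_pos hc hk2)).ne' ENNReal.ofReal_ne_top a ha N ?_
  intro n x hn h1 h2
  have hn1 : 1 ≤ n := hN.trans hn
  have hn0 : (0:ℝ) < n := by exact_mod_cast hn1
  rw [WW_eq k n hn1, ← ENNReal.ofReal_mul (by positivity)]
  apply ENNReal.ofReal_le_ofReal
  calc c / ((k:ℝ)+2)^(k+1) * (√(n:ℝ)^k / (n:ℝ)^(k+1))
      = c * √(n:ℝ)^k / (((k:ℝ)+2)^(k+1) * (n:ℝ)^(k+1)) := by field_simp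
    _ ≤ _ := by
      have h3 := h n (rho x) hn h1 h2
      apply div_le_div₀ (eSpec_nonneg _ _ _) _ (Ddim_pos k n) (Ddim_upper k n hn1)
      rw [eSpec_eq_Erad]
      exact h3

lemma PL_eq (d : ℕ) (p : ℝ) (c : ℕ → ℝ) :
    hermitePLnorm d p c = (If (EE d) (p/2) (fun n => ENNReal.ofReal ((c n)^2))) ^ (1/p) := by
  unfold hermitePLnorm If EE
  congr 3
  funext x
  congr 3
  funext n
  rw [← ENNReal.ofReal_mul (by positivity), mul_div_assoc]

lemma DN_eq (d : ℕ) (p : ℝ) (c : ℕ → ℝ) :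
    hermiteDiscreteNorm d p c = ENNReal.ofReal (c 0) +
      (Qf d (WW d) (p/2) (fun n => ENNReal.ofReal ((c n)^2))) ^ (1/p) := by
  unfold hermiteDiscreteNorm Qf Sf WW
  simp only [div_eq_mul_inv (ENNReal.ofReal _)]

/-- Theorem 6.3, equivalence of norms (50): the probabilistic Lebesgue norm
for the harmonic oscillator is equivalent to an explicit discrete quantity. -/
theorem stmt12 (d : ℕ) (hd : 2 ≤ d) (p : ℝ) (hp : 1 ≤ p) :
    ∃ C : ℝ, 1 ≤ C ∧
      ∀ c : ℕ → ℝ, (∀ n, 0 ≤ c n) →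
        hermiteDiscreteNorm d p c ≤ ENNReal.ofReal C * hermitePLnorm d p c ∧
        hermitePLnorm d p c ≤ ENNReal.ofReal C * hermiteDiscreteNorm d p c := by
  obtain ⟨k, rfl⟩ := Nat.exists_eq_add_of_le' hd
  have hp0 : 0 < p := by linarith
  obtain ⟨C1, hC1, h1⟩ := upper_final k (q := p/2) (by positivity)
  obtain ⟨C2, hC2, h2⟩ := lower_final k (q := p/2) (by positivity)
  have hip : 0 ≤ 1/p := by positivity
  have hD1 : C1 ^ (1/p) ≠ ⊤ := ENNReal.rpow_ne_top_of_nonneg hip hC1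
  have hD2 : C2 ^ (1/p) ≠ ⊤ := ENNReal.rpow_ne_top_of_nonneg hip hC2
  set T : ℝ≥0∞ := 1 + (C1 ^ (1/p) + 2 * C2 ^ (1/p)) with hT
  have hTt : T ≠ ⊤ := by
    rw [hT]
    exact ENNReal.add_ne_top.2 ⟨by simp, ENNReal.add_ne_top.2 ⟨hD1, ENNReal.mul_ne_top (by simp) hD2⟩⟩
  refine ⟨T.toReal, ?_, fun c hc => ?_⟩
  · have : (1:ℝ≥0∞) ≤ T := le_self_add
    simpa using ENNReal.toReal_mono hTt this
  rw [ENNReal.ofReal_toReal hTt, PL_eq, DN_eq]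
  set s : ℕ → ℝ≥0∞ := fun n => ENNReal.ofReal ((c n)^2) with hs
  have hs0 : ((s 0) ^ (p/2)) ^ (1/p) = ENNReal.ofReal (c 0) := by
    have e : s 0 = (ENNReal.ofReal (c 0)) ^ (2:ℝ) := by
      rw [hs]; simp only
      rw [ENNReal.ofReal_pow (hc 0), ← ENNReal.rpow_natCast]; norm_num
    rw [e, ← ENNReal.rpow_mul, ← ENNReal.rpow_mul]
    have : 2 * (p/2 * (1/p)) = 1 := by field_simp
    rw [this, ENNReal.rpow_one]
  constructor
  · obtain ⟨ha, hb⟩ := h2 s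
    have ha' := ENNReal.rpow_le_rpow ha hip
    have hb' := ENNReal.rpow_le_rpow hb hip
    rw [ENNReal.mul_rpow_of_nonneg _ _ hip] at ha' hb'
    rw [hs0] at ha'
    refine (add_le_add ha' hb').trans ?_
    rw [← two_mul, ← mul_assoc]
    refine mul_le_mul' ?_ le_rfl
    rw [hT]
    exact le_add_self.trans le_add_self
  · refine (ENNReal.rpow_le_rpow (h1 s) hip).trans ?_
    rw [ENNReal.mul_rpow_of_nonneg _ _ hip]
    refine mul_le_mul' ?_ ?_
    · rw [hT]
      exact le_self_add.trans le_add_self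
    · rw [← hs0]
      exact ENNReal.rpow_add_le_add_rpow _ _ hip (by rw [div_le_one hp0]; exact hp)
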